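/- arXiv:2010.13079 — 2 statements merged into one kernel-verified Lean document; each statement's English description precedes it below -/
import Mathlib

section
/- Let q = p^e be a power of a prime with q ≡ 1 (mod 6), t = (q-1)/6, ω₆ = ω^t, ω₃ = ω^{2t}, ω₂ = ω^{3t}, and let λ ∈ 𝔽_q with λ ≠ 0 and λ⁶ ≠ 1. Then Σ_{w'∈[0,0,0,1,1,4]} N_q(0,w') + S_{[0,0,0,1,1,4]} + Σ_{w'∈[0,0,0,2,5,5]} N_q(0,w') + S_{[0,0,0,2,5,5]} = q²·ω₆(-1)·J(ω₆,ω₆,ω̄₃)·J(ω₂,ω̄₃,ω̄₆)·₃F₂(ω₆,ω̄₃,ω₂; ε,ω̄₆ | 1/λ⁶)_q + q²·J(ω₃,ω₃,ω₃)·J(ω₂,ω̄₃,ω̄₆)·₃F₂(ω₃,ω̄₆,ω₂; ε,ω₆ | 1/λ⁶)_q. -/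
open scoped Classical

noncomputable section

/-- The Gauss sum `g(χ) = ∑ₓ χ(x) exp(2π√-1 · tr(x)/p)` of a multiplicative character `χ`
of a finite field `F` of characteristic `p`, where `tr : F → 𝔽_p` is the trace map. -/
def gaussChar (p : ℕ) (F : Type) [Field F] [Fintype F] [Algebra (ZMod p) F]
    (χ : MulChar F ℂ) : ℂ :=
  ∑ x : F, χ x *
    Complex.exp (2 * Real.pi * Complex.I * ((Algebra.trace (ZMod p) F x).val : ℂ) / (p : ℂ))

/-- The Jacobi sum `J(χ₁, …, χₙ) = ∑_{x₁ + ⋯ + xₙ = 1} χ₁(x₁) ⋯ χₙ(xₙ)`. -/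
def jacobiS (F : Type) [Field F] [Fintype F] {n : ℕ} (χ : Fin n → MulChar F ℂ) : ℂ :=
  ∑ v ∈ Finset.univ.filter (fun v : Fin n → F => ∑ i, v i = 1), ∏ i, χ i (v i)

/-- The normalized Jacobi sum `binom(A; B) = (B(-1)/q) · J(A, B̄)`. -/
def gBinom (F : Type) [Field F] [Fintype F] (A B : MulChar F ℂ) : ℂ :=
  B (-1) / (Fintype.card F : ℂ) * jacobiS F ![A, B⁻¹]

/-- Greene's finite-field hypergeometric function `ₙ₊₁Fₙ` (case `n ≥ 2`), where the sum over all
multiplicative characters is written as a sum over the powers `ω^j`, `0 ≤ j ≤ q - 2`, of a fixed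
generator `ω` of the character group. -/
def greeneF (F : Type) [Field F] [Fintype F] (ω : MulChar F ℂ) {n : ℕ}
    (A : Fin (n + 1) → MulChar F ℂ) (B : Fin n → MulChar F ℂ) (x : F) : ℂ :=
  (Fintype.card F : ℂ) / ((Fintype.card F : ℂ) - 1) *
    ∑ j ∈ Finset.range (Fintype.card F - 1),
      gBinom F (A 0 * ω ^ j) (ω ^ j) *
        (∏ i : Fin n, gBinom F (A i.succ * ω ^ j) (B i * ω ^ j)) * (ω ^ j) x

/-- Greene's finite-field hypergeometric function `₂F₁` (case `n = 1`):
`₂F₁(A₀, A₁; B₁ | x) = ε(x) · (A₁B₁(-1)/q) · ∑_y A₁(y) (A̅₁B₁)(1-y) A̅₀(1-xy)`. -/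
def greene2F1 (F : Type) [Field F] [Fintype F] (A₀ A₁ B₁ : MulChar F ℂ) (x : F) : ℂ :=
  (1 : MulChar F ℂ) x * ((A₁ * B₁) (-1) / (Fintype.card F : ℂ)) *
    ∑ y : F, A₁ y * (A₁⁻¹ * B₁) (1 - y) * A₀⁻¹ (1 - x * y)

/-- The number of `F`-rational points of the Dwork hypersurface
`x₁^d + ⋯ + x_d^d = dλ x₁ ⋯ x_d` in projective space. -/
def dworkCount (F : Type) [Field F] [Fintype F] (d : ℕ) (lam : F) : ℕ :=
  Nat.card {P : Projectivization F (Fin d → F) //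
    ∑ i, P.rep i ^ d = (d : F) * lam * ∏ i, P.rep i}

/-- The number of `F`-rational points of the diagonal hypersurface
`x₁^d + ⋯ + xₙ^d = dλ x₁^{h₁} ⋯ xₙ^{hₙ}` in projective space. -/
def diagCount (F : Type) [Field F] [Fintype F] (d n : ℕ) (h : Fin n → ℕ) (lam : F) : ℕ :=
  Nat.card {P : Projectivization F (Fin n → F) //
    ∑ i, P.rep i ^ d = (d : F) * lam * ∏ i, P.rep i ^ h i}

/-- The quantity `N_q(0, w)` from Koblitz's formula, with `t = (q - 1)/d`. -/
def NqW (p : ℕ) (F : Type) [Field F] [Fintype F] [Algebra (ZMod p) F]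
    (ω : MulChar F ℂ) (d : ℕ) {n : ℕ} (w : Fin n → ZMod d) : ℂ :=
  if ∀ i, w i = 0 then ((Fintype.card F : ℂ) ^ (n - 1) - 1) / ((Fintype.card F : ℂ) - 1)
  else if ∀ i, w i ≠ 0 then
    (1 / (Fintype.card F : ℂ)) *
      ∏ i, gaussChar p F (ω ^ ((w i).val * ((Fintype.card F - 1) / d)))
  else 0

/-- The quantity `S_{[w]} = (q-1)⁻¹ ∑_{j=0}^{q-2} (∏ᵢ g(ω^{wᵢt + hᵢj}) / g(ω^{dj})) ω^{dj}(dλ)`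
from Koblitz's formula, with `t = (q - 1)/d`. -/
def SW (p : ℕ) (F : Type) [Field F] [Fintype F] [Algebra (ZMod p) F]
    (ω : MulChar F ℂ) (d : ℕ) {n : ℕ} (h : Fin n → ℕ) (w : Fin n → ZMod d) (lam : F) : ℂ :=
  ((Fintype.card F : ℂ) - 1)⁻¹ *
    ∑ j ∈ Finset.range (Fintype.card F - 1),
      (∏ i, gaussChar p F (ω ^ ((w i).val * ((Fintype.card F - 1) / d) + h i * j))) /
          gaussChar p F (ω ^ (d * j)) * (ω ^ (d * j)) ((d : F) * lam)

end



namespace HD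
set_option linter.unusedSectionVars false
open Finset

variable {F : Type} [Field F] [Fintype F]

/-- kernel of a character of order `m` consists of `m`-th powers -/
lemma exists_root_of_apply_eq_one (β : MulChar F ℂ) (r : F) (hr : r ≠ 0) (h : β r = 1) :
    ∃ v : F, v ^ orderOf β = r := by
  obtain ⟨γ, hγ⟩ := IsCyclic.exists_generator (α := Fˣ)
  obtain ⟨k, hk⟩ := mem_powers_iff_mem_zpowers.mpr (hγ (Units.mk0 r hr))
  have hk' : ((γ : F)) ^ k = r := by
    have := congrArg (fun u : Fˣ => (u : F)) hk
    simpa using this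
  have h1 : β ^ k = 1 := by
    rw [MulChar.eq_iff hγ, MulChar.pow_apply_coe, ← map_pow, hk', h]
    simp
  obtain ⟨l, hl⟩ := orderOf_dvd_of_pow_eq_one h1
  exact ⟨(γ : F) ^ l, by rw [← pow_mul, mul_comm, ← hl, hk']⟩

lemma gauss_mul_inv {ψ : AddChar F ℂ} (hψ : ψ.IsPrimitive) {χ : MulChar F ℂ} (hχ : χ ≠ 1) :
    gaussSum χ ψ * gaussSum χ⁻¹ ψ = χ (-1) * Fintype.card F := by
  have h := gaussSum_mul_gaussSum_eq_card hχ hψ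
  have h2 := mul_gaussSum_inv_eq_gaussSum χ⁻¹ ψ
  have h3 : χ⁻¹ (-1) = χ (-1) := by rw [MulChar.inv_apply']; norm_num
  rw [← h2, h3, ← h]; ring

lemma gauss_one {ψ : AddChar F ℂ} (hψ : ψ.IsPrimitive) :
    gaussSum (1 : MulChar F ℂ) ψ = -1 := by
  apply gaussSum_one_left
  intro h
  exact hψ (one_ne_zero) (by rw [AddChar.mulShift_one]; exact h)

lemma chi_ne {χ : MulChar F ℂ} {a : F} (ha : a ≠ 0) : χ a ≠ 0 :=
  MulChar.apply_ne_zero_iff.2 (isUnit_iff_ne_zero.2 ha)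

lemma chi_one {a : F} (ha : a ≠ 0) : (1 : MulChar F ℂ) a = 1 :=
  MulChar.one_apply (isUnit_iff_ne_zero.2 ha)

lemma card_ne : (Fintype.card F : ℂ) ≠ 0 := by
  exact_mod_cast Fintype.card_ne_zero

lemma gauss_ne {ψ : AddChar F ℂ} (hψ : ψ.IsPrimitive) (χ : MulChar F ℂ) : gaussSum χ ψ ≠ 0 := by
  by_cases h : χ = 1
  · rw [h, gauss_one hψ]; norm_num
  · exact left_ne_zero_of_mul (b := gaussSum χ⁻¹ ψ) (by
      rw [gauss_mul_inv hψ h]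
      exact mul_ne_zero (chi_ne (by simp)) card_ne)

lemma eq_of_sq {η χ : MulChar F ℂ} (hη : η ≠ 1) (hη2 : η ^ 2 = 1) (hχ : χ ≠ 1) (hχ2 : χ ^ 2 = 1) :
    χ = η := by
  have key : ∀ (A B : MulChar F ℂ), A ≠ 1 → A ^ 2 = 1 → B ^ 2 = 1 → ∀ a : F, a ≠ 0 → A a = 1 →
      B a = 1 := by
    intro A B hA hA2 hB2 a ha h
    obtain ⟨v, hv⟩ := exists_root_of_apply_eq_one A a ha h
    rw [orderOf_eq_prime hA2 hA] at hv
    have hv0 : v ≠ 0 := by rintro rfl; exact ha (by rw [← hv]; simp)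
    rw [← hv, map_pow, ← MulChar.pow_apply' _ two_ne_zero, hB2, chi_one hv0]
  have val : ∀ (A : MulChar F ℂ), A ^ 2 = 1 → ∀ a : F, a ≠ 0 → A a = 1 ∨ A a = -1 := by
    intro A hA a ha
    have h : (A a) ^ 2 = 1 := by
      rw [← MulChar.pow_apply' _ two_ne_zero, hA, chi_one ha]
    simpa using h
  apply MulChar.ext
  intro a
  rcases val χ hχ2 a a.ne_zero with h | h
  · rw [h, key χ η hχ hχ2 hη2 a a.ne_zero h]
  · rcases val η hη2 a a.ne_zero with h' | h'
    · rw [h', key η χ hη hη2 hχ2 a a.ne_zero h']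
    · rw [h, h']

lemma jac_dup (h2 : (2 : F) ≠ 0) {η χ : MulChar F ℂ} (hη : η ≠ 1) (hη2 : η ^ 2 = 1) (hχ : χ ≠ 1) :
    jacobiSum χ η = χ 4 * jacobiSum χ χ := by
  have hF : ringChar F ≠ 2 := by
    intro h
    apply h2
    have := ringChar.Nat.cast_ringChar (R := F)
    rw [h] at this; exact_mod_cast this
  have hq : η = (quadraticChar F).ringHomComp (Int.castRingHom ℂ) := by
    symm
    apply eq_of_sq hη hη2
    · rw [MulChar.ringHomComp_ne_one_iff (by exact Int.cast_injective)]
      exact quadraticChar_ne_one hF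
    · rw [MulChar.ringHomComp_pow, (quadraticChar_isQuadratic F).sq_eq_one]
      simp
  have hcount : ∀ a : F, ((univ.filter (fun z : F => z ^ 2 = a)).card : ℂ) = η a + 1 := by
    intro a
    have := quadraticChar_card_sqrts hF a
    have h3 := congrArg (fun n : ℤ => (n : ℂ)) this
    simp only [Int.cast_natCast, Int.cast_add, Int.cast_one] at h3
    rw [hq, MulChar.ringHomComp_apply]
    simp only [Int.coe_castRingHom]
    rw [← h3]
    congr 2
    ext z; simp
  have e1 : jacobiSum χ η = ∑ x : F, χ x * (η (1 - x) + 1) := by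
    simp only [mul_add, mul_one, sum_add_distrib, MulChar.sum_eq_zero_of_ne_one hχ, add_zero]
    rfl
  rw [e1]
  have e2 : ∀ x : F, χ x * (η (1 - x) + 1) = ∑ z : F, if z ^ 2 = 1 - x then χ x else 0 := by
    intro x
    rw [← hcount, ← sum_filter, sum_const, nsmul_eq_mul, mul_comm]
  simp_rw [e2]
  rw [sum_comm]
  have e3 : ∀ z : F, (∑ x : F, if z ^ 2 = 1 - x then χ x else 0) = χ (1 - z ^ 2) := by
    intro z
    rw [sum_eq_single (1 - z ^ 2)]
    · simp
    · intro b _ hb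
      rw [if_neg]
      intro h; apply hb; rw [h]; ring
    · simp
  simp_rw [e3]
  unfold jacobiSum
  rw [mul_sum]
  symm
  apply Fintype.sum_equiv ((Equiv.mulLeft₀ (2 : F) h2).trans (Equiv.subLeft (1 : F)))
  intro x
  simp only [Equiv.trans_apply, Equiv.subLeft_apply, Equiv.mulLeft₀_apply]
  rw [← map_mul, ← map_mul]
  congr 1; ring

theorem hd2 {ψ : AddChar F ℂ} (hψ : ψ.IsPrimitive) (h2 : (2 : F) ≠ 0) {η : MulChar F ℂ}
    (hη : η ≠ 1) (hη2 : η ^ 2 = 1) (χ : MulChar F ℂ) :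
    χ 4 * (gaussSum χ ψ * gaussSum (χ * η) ψ) = gaussSum (χ ^ 2) ψ * gaussSum η ψ := by
  have h4 : (4 : F) = 2 ^ 2 := by norm_num
  by_cases hc : χ ^ 2 = 1
  · have : χ 4 = 1 := by
      rw [h4, map_pow, ← MulChar.pow_apply' _ two_ne_zero, hc, chi_one h2]
    rw [this, hc]
    by_cases h1 : χ = 1
    · subst h1; simp
    · have := eq_of_sq hη hη2 h1 hc
      subst this
      rw [← pow_two, hc]; ring
  · have h1 : χ ≠ 1 := by rintro rfl; simp at hc
    have h3 : χ * η ≠ 1 := by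
      intro h
      apply hc
      have : (χ * η) ^ 2 = 1 := by rw [h]; simp
      rwa [mul_pow, hη2, mul_one] at this
    have j1 := jacobiSum_mul_nontrivial h3 ψ
    have j2 := jacobiSum_mul_nontrivial (χ := χ) (φ := χ) (by rwa [← pow_two]) ψ
    rw [jac_dup h2 hη hη2 h1] at j1
    rw [← pow_two] at j2
    apply mul_left_cancel₀ (gauss_ne hψ χ)
    linear_combination (-χ 4 * gaussSum (χ * η) ψ) * j2 + gaussSum (χ^2) ψ * j1

end HD


namespace HD
open Finset
set_option linter.unusedSectionVars false
variable {F : Type} [Field F] [Fintype F]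

/-- number of roots -/
noncomputable def R (c : F) : ℕ := (univ.filter (fun y : F => y ^ 3 = -27 * c * (1 - y))).card

/-- character sum -/
noncomputable def M (β : MulChar F ℂ) (c : F) : ℂ :=
  ∑ x ∈ univ.filter (fun x : F => x * (1 - x) = c), β (x / (1 - x))

lemma R_le_three (c : F) : R c ≤ 3 := by
  open Polynomial in
  let P : F[X] := X ^ 3 + (C (-27 * c) * X + C (27 * c))
  have hd : (C (-27 * c) * X + C (27 * c)).degree < ((3 : ℕ) : WithBot ℕ) :=
    lt_of_le_of_lt degree_linear_le (by norm_num)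
  have hP : P.Monic := monic_X_pow_add hd
  have hn : P.natDegree ≤ 3 := by
    apply natDegree_le_of_degree_le
    exact (degree_add_le _ _).trans (max_le (by simp) hd.le)
  have : (univ.filter (fun y : F => y ^ 3 = -27 * c * (1 - y))) ⊆ P.roots.toFinset := by
    intro y hy
    simp only [mem_filter, mem_univ, true_and] at hy
    simp only [Multiset.mem_toFinset, mem_roots hP.ne_zero, IsRoot.def]
    simp only [P, eval_add, eval_pow, eval_X, eval_mul, eval_C]
    linear_combination hy
  calc R c ≤ P.roots.toFinset.card := card_le_card this
    _ ≤ P.roots.card := Multiset.toFinset_card_le _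
    _ ≤ P.natDegree := card_roots' _
    _ ≤ 3 := hn

/-- in the non-split case there is at most one root -/
lemma R_le_one {θ : F} (hθ : θ ^ 2 = -3) (h2 : (2 : F) ≠ 0) (h3 : (3 : F) ≠ 0) {c : F} (hc : c ≠ 0)
    (h : ∀ x : F, x * (1 - x) ≠ c) : R c ≤ 1 := by
  rw [R, card_le_one]
  intro y1 h1 y2 h2'
  simp only [mem_filter, mem_univ, true_and] at h1 h2'
  by_contra hne
  have hs : y1 - y2 ≠ 0 := sub_ne_zero.2 hne
  have e1 : y1 ^ 2 + y1 * y2 + y2 ^ 2 = 27 * c := by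
    apply mul_left_cancel₀ hs
    linear_combination h1 - h2'
  have e2 : y1 * y2 * (y1 + y2) = 27 * c := by
    linear_combination y1 * e1 - h1
  have hθ0 : θ ≠ 0 := by rintro rfl; apply h3; linear_combination hθ
  have h81 : (81 : F) ≠ 0 := by
    have : (81 : F) = 3 ^ 4 := by norm_num
    rw [this]; exact pow_ne_zero _ h3
  set D := (y1 - y2) * (y1 + (y1 + y2)) * (y2 + (y1 + y2)) with hD
  have hD2 : D ^ 2 = 4 * (27 * c) ^ 3 - 27 * (27 * c) ^ 2 := by
    rw [hD]
    calc _ = 4 * (y1 ^ 2 + y1 * y2 + y2 ^ 2) ^ 3 - 27 * (y1 * y2 * (y1 + y2)) ^ 2 := by ring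
      _ = _ := by rw [e1, e2]
  set s := D / (81 * θ * c) with hsdef
  have hsD : s * (81 * θ * c) = D := by rw [hsdef]; field_simp
  have hs2 : s ^ 2 = 1 - 4 * c := by
    have hz : (81 * θ * c) ^ 2 ≠ 0 := by exact pow_ne_zero _ (mul_ne_zero (mul_ne_zero h81 hθ0) hc)
    apply mul_right_cancel₀ hz
    rw [← mul_pow, hsD, hD2]
    linear_combination (-(1 - 4 * c) * 81 ^ 2 * c ^ 2) * hθ
  apply h ((1 - s) / 2)
  field_simp
  linear_combination -hs2

/-- a root in the split case gives a cube -/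
lemma cube_of_root (h2 : (2 : F) ≠ 0) (h3 : (3 : F) ≠ 0) {x y : F} (hx : x ≠ 0) (hx1 : 1 - x ≠ 0)
    (hy : y ^ 3 = -27 * (x * (1 - x)) * (1 - y)) : ∃ v : F, v ^ 3 = x / (1 - x) := by
  have h27 : (27 : F) ≠ 0 := by
    have : (27 : F) = 3 ^ 3 := by norm_num
    rw [this]; exact pow_ne_zero _ h3
  have hy1 : 1 - y ≠ 0 := by
    intro h
    rw [h, mul_zero] at hy
    have : y = 0 := by simpa using hy
    rw [this] at h; simp at h
  have hy0 : y ≠ 0 := by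
    rintro rfl
    have : (27 : F) * (x * (1 - x)) = 0 := by linear_combination hy
    exact mul_ne_zero h27 (mul_ne_zero hx hx1) this
  have hdisc : 27 * (1 - y) * (1 - 2 * x) ^ 2 = (y + 3) * (2 * y - 3) ^ 2 := by
    linear_combination (-4) * hy
  by_cases hy32 : 2 * y - 3 = 0
  · rw [hy32] at hdisc
    have : (1 - 2 * x) ^ 2 = 0 := by
      apply mul_left_cancel₀ (mul_ne_zero h27 hy1)
      rw [hdisc]; ring
    have h' : 1 - 2 * x = 0 := by simpa using this
    refine ⟨1, ?_⟩
    rw [eq_div_iff hx1]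
    linear_combination h'
  · set S := 9 * (1 - y) * (1 - 2 * x) / (2 * y - 3) with hS
    have hS' : S * (2 * y - 3) = 9 * (1 - y) * (1 - 2 * x) := by rw [hS, div_mul_cancel₀ _ hy32]
    have hS2 : S ^ 2 = 3 * (1 - y) * (3 + y) := by
      apply mul_right_cancel₀ (pow_ne_zero 2 hy32)
      rw [← mul_pow, hS']
      linear_combination 3 * (1 - y) * hdisc
    set v := (y - 3 + S) / (2 * y) with hv
    have hv' : 2 * y * v = y - 3 + S := by rw [hv]; field_simp
    have hq : y * (1 - v + v ^ 2) = - 3 * v := by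
      have h4 : (4 * y) ≠ 0 := by
        have : (4 : F) = 2 ^ 2 := by norm_num
        rw [this]; exact mul_ne_zero (pow_ne_zero _ h2) hy0
      apply mul_left_cancel₀ h4
      have : S = 2 * y * v - (y - 3) := by rw [hv']; ring
      rw [this] at hS2
      linear_combination hS2
    have hv0 : v ≠ 0 := by
      intro h; rw [h] at hq; apply hy0; linear_combination hq
    have hw : 1 - v + v ^ 2 ≠ 0 := by
      intro h; rw [h, mul_zero] at hq
      have : 3 * v = 0 := by linear_combination hq
      exact mul_ne_zero h3 hv0 this
    have hv1 : 1 + v ≠ 0 := by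
      intro h
      have : v = -1 := by linear_combination h
      rw [this] at hq
      apply hy1
      apply mul_left_cancel₀ h3
      linear_combination -hq
    have h5 : (1 - y) * (1 - v + v ^ 2) = (1 + v) ^ 2 := by linear_combination -hq
    have hc : x * (1 - x) * (1 + v ^ 3) ^ 2 = v ^ 3 := by
      have e : y ^ 3 * (1 - v + v ^ 2) ^ 3 = -27 * v ^ 3 := by
        rw [← mul_pow, hq]; ring
      rw [hy] at e
      apply mul_left_cancel₀ h27
      linear_combination -e - 27 * (x * (1 - x)) * (1 - v + v ^ 2) ^ 2 * h5
    have hfac : (x * (1 + v ^ 3) - v ^ 3) * (x * (1 + v ^ 3) - 1) = 0 := by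
      linear_combination -hc
    rcases mul_eq_zero.1 hfac with h | h
    · exact ⟨v, by rw [eq_div_iff hx1]; linear_combination -h⟩
    · refine ⟨v⁻¹, ?_⟩
      rw [eq_div_iff hx1]
      field_simp
      linear_combination -h


lemma sum_three {β : MulChar F ℂ} (hβ : β ≠ 1) (hβ3 : β ^ 3 = 1) {r : F} (hr : r ≠ 0)
    (hnc : ¬ ∃ v : F, v ^ 3 = r) : 1 + β r + β r⁻¹ = 0 := by
  have hne : β r ≠ 1 := by
    intro h
    apply hnc
    have := exists_root_of_apply_eq_one β r hr h
    have h3 : Fact (Nat.Prime 3) := ⟨Nat.prime_three⟩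
    rwa [orderOf_eq_prime hβ3 hβ] at this
  have h3 : (β r) ^ 3 = 1 := by
    rw [← MulChar.pow_apply' _ three_ne_zero, hβ3, chi_one hr]
  have h4 : β r⁻¹ = (β r) ^ 2 := by
    apply mul_left_cancel₀ (chi_ne hr)
    rw [← map_mul, mul_inv_cancel₀ hr, map_one, ← pow_succ', h3]
  rw [h4]
  have : (β r - 1) ≠ 0 := sub_ne_zero.2 hne
  apply mul_left_cancel₀ this
  linear_combination h3

lemma val_cube {β : MulChar F ℂ} (hβ3 : β ^ 3 = 1) {r : F} (hr : r ≠ 0)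
    (hc : ∃ v : F, v ^ 3 = r) : β r = 1 := by
  obtain ⟨v, rfl⟩ := hc
  have : v ≠ 0 := by rintro rfl; simp at hr
  rw [map_pow, ← MulChar.pow_apply' _ three_ne_zero, hβ3, chi_one this]

lemma R_le_M {θ : F} (hθ : θ ^ 2 = -3) (h2 : (2 : F) ≠ 0) (h3 : (3 : F) ≠ 0)
    {β : MulChar F ℂ} (hβ : β ≠ 1) (hβ3 : β ^ 3 = 1) {c : F} (hc : c ≠ 0) :
    ∃ m : ℕ, (m : ℂ) = 1 + M β c ∧ R c ≤ m := by
  by_cases h : ∀ x : F, x * (1 - x) ≠ c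
  · refine ⟨1, ?_, R_le_one hθ h2 h3 hc h⟩
    have : univ.filter (fun x : F => x * (1 - x) = c) = ∅ := by
      ext x; simp [h x]
    rw [M, this]; simp
  push Not at h
  obtain ⟨x, rfl⟩ := h
  have hx : x ≠ 0 := left_ne_zero_of_mul hc
  have hx1 : 1 - x ≠ 0 := right_ne_zero_of_mul hc
  have hset : univ.filter (fun z : F => z * (1 - z) = x * (1 - x)) = {x, 1 - x} := by
    ext z
    simp only [mem_filter, mem_univ, true_and, mem_insert, mem_singleton]
    constructor
    · intro h
      have : (z - x) * (z - (1 - x)) = 0 := by linear_combination -h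
      rcases mul_eq_zero.1 this with h | h
      · exact Or.inl (sub_eq_zero.1 h)
      · exact Or.inr (sub_eq_zero.1 h)
    · rintro (rfl | rfl) <;> ring
  have hr : x / (1 - x) ≠ 0 := div_ne_zero hx hx1
  by_cases hh : x = 1 - x
  · have hM : M β (x * (1 - x)) = 1 := by
      rw [M, hset, ← hh, pair_eq_singleton, sum_singleton, ← hh, div_self hx, map_one]
    refine ⟨2, by rw [hM]; norm_num, ?_⟩
    have hx' : x = 1 / 2 := by rw [eq_div_iff h2]; linear_combination hh
    have : univ.filter (fun y : F => y ^ 3 = -27 * (x * (1 - x)) * (1 - y)) ⊆ {-3, 3 / 2} := by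
      intro y hy
      simp only [mem_filter, mem_univ, true_and, mem_insert, mem_singleton] at hy ⊢
      rw [← hh] at hy
      have h4 : 2 * x = 1 := by linear_combination hh
      have : (y + 3) * (2 * y - 3) ^ 2 = 0 := by
        linear_combination 4 * hy + (-27 * (2 * x + 1) * (1 - y)) * h4
      rcases mul_eq_zero.1 this with h | h
      · left; linear_combination h
      · right
        have h : 2 * y - 3 = 0 := by simpa using h
        rw [eq_div_iff h2]; linear_combination h
    exact (card_le_card this).trans card_le_two
  · have hM : M β (x * (1 - x)) = β (x / (1 - x)) + β (x / (1 - x))⁻¹ := by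
      rw [M, hset, sum_pair hh]
      congr 2
      rw [inv_div]; ring
    by_cases hcube : ∃ v : F, v ^ 3 = x / (1 - x)
    · refine ⟨3, ?_, R_le_three _⟩
      have hcube' : ∃ v : F, v ^ 3 = (x / (1 - x))⁻¹ := by
        obtain ⟨v, hv⟩ := hcube
        exact ⟨v⁻¹, by rw [inv_pow, hv]⟩
      rw [hM, val_cube hβ3 hr hcube, val_cube hβ3 (inv_ne_zero hr) hcube']
      norm_num
    · refine ⟨0, ?_, ?_⟩
      · rw [hM, ← add_assoc, sum_three hβ hβ3 hr hcube]; simp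
      · rw [R, Nat.le_zero, card_eq_zero, filter_eq_empty_iff]
        intro y _ hy
        exact hcube (cube_of_root h2 h3 hx hx1 hy)

/-- fibrewise summation -/
lemma sum_fib_M (χ β : MulChar F ℂ) :
    ∑ c : F, χ c * M β c = jacobiSum (χ * β) (χ * β⁻¹) := by
  have : ∀ c : F, χ c * M β c =
      ∑ x : F, if x * (1 - x) = c then χ (x * (1 - x)) * β (x / (1 - x)) else 0 := by
    intro c
    rw [M, mul_sum, sum_filter]
    apply sum_congr rfl
    intro x _
    split_ifs with h
    · rw [h]
    · rfl
  simp_rw [this]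
  rw [sum_comm]
  unfold jacobiSum
  apply sum_congr rfl
  intro x _
  rw [sum_ite_eq, if_pos (mem_univ _), div_eq_mul_inv, map_mul, map_mul, MulChar.mul_apply,
    MulChar.mul_apply, MulChar.inv_apply']
  ring

lemma sum_fib_R (h3 : (3 : F) ≠ 0) (χ : MulChar F ℂ) :
    χ (-27) * ∑ c : F, χ c * R c = jacobiSum (χ ^ 3) χ⁻¹ := by
  have h27 : (-27 : F) ≠ 0 := by
    have : (-27 : F) = (-3) ^ 3 := by norm_num
    rw [this]; exact pow_ne_zero _ (neg_ne_zero.2 h3)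
  have e0 : ∀ c : F, χ c * R c =
      ∑ y : F, if y ^ 3 = -27 * c * (1 - y) then χ c else 0 := by
    intro c
    rw [R, ← sum_filter, sum_const, nsmul_eq_mul, mul_comm]
  simp_rw [e0]
  rw [sum_comm, mul_sum]
  unfold jacobiSum
  apply sum_congr rfl
  intro y _
  rw [MulChar.pow_apply' _ three_ne_zero, MulChar.inv_apply', ← map_pow, ← map_mul]
  by_cases hy : 1 - y = 0
  · have hy' : y = 1 := by linear_combination -hy
    simp [hy', MulChar.map_zero]
  · rw [sum_eq_single (y ^ 3 * (1 - y)⁻¹ / (-27))]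
    · rw [if_pos (by rw [mul_div_cancel₀ _ h27, mul_assoc, inv_mul_cancel₀ hy, mul_one]), ← map_mul,
        mul_div_cancel₀ _ h27]
    · intro b _ hb
      rw [if_neg]
      intro h
      apply hb
      rw [h, mul_assoc, mul_inv_cancel₀ hy, mul_one, mul_div_cancel_left₀ _ h27]
    · simp

lemma R_eq_M {θ : F} (hθ : θ ^ 2 = -3) (h2 : (2 : F) ≠ 0) (h3 : (3 : F) ≠ 0)
    {β : MulChar F ℂ} (hβ : β ≠ 1) (hβ3 : β ^ 3 = 1) {c : F} (hc : c ≠ 0) :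
    (R c : ℂ) = 1 + M β c := by
  have key := fun (c : {c : F // c ≠ 0}) => R_le_M hθ h2 h3 hβ hβ3 c.2
  choose m hm hle using key
  have h27 : (-27 : F) ≠ 0 := by
    have : (-27 : F) = (-3) ^ 3 := by norm_num
    rw [this]; exact pow_ne_zero _ (neg_ne_zero.2 h3)
  have conv : ∀ f : F → ℂ, ∑ c : {c : F // c ≠ 0}, f c = ∑ c : F, (1 : MulChar F ℂ) c * f c := by
    intro f
    rw [← Finset.sum_subtype (univ.filter (fun c : F => c ≠ 0)) (by simp) f, sum_filter]
    apply sum_congr rfl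
    intro c _
    by_cases h : c = 0
    · simp [h, MulChar.map_zero]
    · simp [h, chi_one h]
  have s1 : ∑ c : {c : F // c ≠ 0}, (R c.1 : ℂ) = Fintype.card F - 2 := by
    rw [conv (fun c => (R c : ℂ))]
    have := sum_fib_R h3 (1 : MulChar F ℂ)
    rw [chi_one h27, one_mul] at this
    rw [this]; simp [jacobiSum_one_one]
  have s2 : ∑ c : {c : F // c ≠ 0}, (m c : ℂ) = Fintype.card F - 2 := by
    simp_rw [hm]
    rw [conv (fun c => 1 + M β c)]
    simp only [mul_add, sum_add_distrib, sum_fib_M, mul_one, one_mul]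
    rw [jacobiSum_nontrivial_inv hβ, MulChar.val_neg_one_eq_one_of_odd_order (n := 3) (by decide) hβ3,
      MulChar.sum_one_eq_card_units, Fintype.card_eq_card_units_add_one (α := F)]
    push_cast; ring
  have s3 : ∑ c : {c : F // c ≠ 0}, R c.1 = ∑ c : {c : F // c ≠ 0}, m c := by
    have := s1.trans s2.symm
    exact_mod_cast this
  have s4 := (Finset.sum_eq_sum_iff_of_le (fun i _ => hle i)).1 s3 ⟨c, hc⟩ (mem_univ _)
  rw [← hm ⟨c, hc⟩, ← s4]

theorem hd3 {ψ : AddChar F ℂ} (hψ : ψ.IsPrimitive) {θ : F} (hθ : θ ^ 2 = -3)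
    (h2 : (2 : F) ≠ 0) (h3 : (3 : F) ≠ 0)
    {β : MulChar F ℂ} (hβ : β ≠ 1) (hβ3 : β ^ 3 = 1) (χ : MulChar F ℂ) :
    χ 27 * (gaussSum χ ψ * gaussSum (χ * β) ψ * gaussSum (χ * β⁻¹) ψ) =
      Fintype.card F * gaussSum (χ ^ 3) ψ := by
  have hβm : β (-1) = 1 := MulChar.val_neg_one_eq_one_of_odd_order (n := 3) (by decide) hβ3
  have hm1 : χ (-1) * χ (-1) = 1 := by rw [← map_mul]; simp
  have h27' : χ (-27) = χ (-1) * χ 27 := by rw [← map_mul]; congr 1; ring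
  by_cases hc : χ ^ 2 = 1
  · have hχ3 : χ ^ 3 = χ := by rw [pow_succ, hc, one_mul]
    have hθ0 : θ ≠ 0 := by rintro rfl; apply h3; linear_combination hθ
    have hne : χ * β ≠ 1 := by
      intro h
      apply hβ
      have : (χ * β) ^ 2 = 1 := by rw [h]; simp
      rw [mul_pow, hc, one_mul] at this
      rw [pow_succ, this, one_mul] at hβ3
      exact hβ3
    have hinv : (χ * β)⁻¹ = χ * β⁻¹ := by
      rw [mul_inv]
      congr 1
      rw [inv_eq_iff_mul_eq_one, ← pow_two, hc]
    have h27 : χ (-27) = 1 := by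
      have : (-27 : F) = (3 * θ) ^ 2 := by linear_combination (-9) * hθ
      rw [this, map_pow, ← MulChar.pow_apply' _ two_ne_zero, hc, chi_one (mul_ne_zero h3 hθ0)]
    have g := gauss_mul_inv hψ hne
    rw [hinv, MulChar.mul_apply, hβm] at g
    rw [hχ3]
    rw [h27'] at h27
    linear_combination χ 27 * gaussSum χ ψ * g + Fintype.card F * gaussSum χ ψ * h27
  · have hχ : χ ≠ 1 := by rintro rfl; simp at hc
    have J : χ (-27) * jacobiSum (χ * β) (χ * β⁻¹) = jacobiSum (χ ^ 3) χ⁻¹ := by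
      rw [← sum_fib_M, ← sum_fib_R h3]
      congr 1
      have : ∀ c : F, χ c * (R c : ℂ) = χ c + χ c * M β c := by
        intro c
        by_cases h : c = 0
        · simp [h, MulChar.map_zero]
        · rw [R_eq_M hθ h2 h3 hβ hβ3 h]; ring
      simp_rw [this]
      rw [sum_add_distrib, MulChar.sum_eq_zero_of_ne_one hχ, zero_add]
    have p1 : χ * β * (χ * β⁻¹) = χ ^ 2 := by
      rw [mul_mul_mul_comm, mul_inv_cancel, mul_one, pow_two]
    have p2 : χ ^ 3 * χ⁻¹ = χ ^ 2 := by
      rw [pow_succ, mul_assoc, mul_inv_cancel, mul_one]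
    have j1 := jacobiSum_mul_nontrivial (χ := χ * β) (φ := χ * β⁻¹) (by rwa [p1]) ψ
    have j2 := jacobiSum_mul_nontrivial (χ := χ ^ 3) (φ := χ⁻¹) (by rwa [p2]) ψ
    rw [p1] at j1
    rw [p2, ← J] at j2
    have g := gauss_mul_inv hψ hχ
    rw [h27'] at j2
    have : χ 27 * (gaussSum (χ * β) ψ * gaussSum (χ * β⁻¹) ψ) = χ (-1) * (gaussSum (χ ^ 3) ψ * gaussSum χ⁻¹ ψ) := by
      rw [← j1, ← j2]
      linear_combination (-χ 27 * (gaussSum (χ ^ 2) ψ * jacobiSum (χ * β) (χ * β⁻¹))) * hm1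
    linear_combination gaussSum χ ψ * this + χ (-1) * gaussSum (χ ^ 3) ψ * g + Fintype.card F * gaussSum (χ ^ 3) ψ * hm1

theorem hd6 {ψ : AddChar F ℂ} (hψ : ψ.IsPrimitive) {θ : F} (hθ : θ ^ 2 = -3)
    (h2 : (2 : F) ≠ 0) (h3 : (3 : F) ≠ 0)
    {α : MulChar F ℂ} (ha6 : α ^ 6 = 1) (ha3 : α ^ 3 ≠ 1) (ha2 : α ^ 2 ≠ 1) (χ : MulChar F ℂ) :
    (χ ^ 6) 6 * (gaussSum χ ψ * gaussSum (χ * α) ψ * gaussSum (χ * α ^ 2) ψ *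
      gaussSum (χ * α ^ 3) ψ * gaussSum (χ * α ^ 4) ψ * gaussSum (χ * α ^ 5) ψ) =
      α (-1) * (Fintype.card F : ℂ) ^ 2 * gaussSum (χ ^ 6) ψ * gaussSum (α ^ 3) ψ := by
  have hb : (α ^ 2) ^ 3 = 1 := by rw [← pow_mul]; exact ha6
  have he : (α ^ 3) ^ 2 = 1 := by rw [← pow_mul]; exact ha6
  have hbi : (α ^ 2)⁻¹ = α ^ 4 := by rw [inv_eq_iff_mul_eq_one, ← pow_add]; exact ha6
  have A := hd3 hψ hθ h2 h3 ha2 hb χ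
  have B := hd3 hψ hθ h2 h3 ha2 hb (χ * α ^ 3)
  have C := hd2 hψ h2 ha3 he (χ ^ 3)
  have m1 : χ * α ^ 3 * α ^ 2 = χ * α ^ 5 := by rw [mul_assoc, ← pow_add]
  have m2 : χ * α ^ 3 * α ^ 4 = χ * α := by
    rw [mul_assoc, ← pow_add, show 3 + 4 = 6 + 1 from rfl, pow_add, ha6, one_mul, pow_one]
  have m3 : (χ * α ^ 3) ^ 3 = χ ^ 3 * α ^ 3 := by
    rw [mul_pow]; congr 1
    rw [pow_succ, he, one_mul]
  rw [hbi] at A B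
  rw [m1, m2, m3, MulChar.mul_apply] at B
  rw [← pow_mul] at C
  have hθ0 : θ ≠ 0 := by rintro rfl; apply h3; linear_combination hθ
  have hη27 : (α ^ 3) 27 = α (-1) := by
    have e1 : (α ^ 3) (-27) = 1 := by
      have : (-27 : F) = (3 * θ) ^ 2 := by linear_combination (-9) * hθ
      rw [this, map_pow, ← MulChar.pow_apply' _ two_ne_zero, he, chi_one (mul_ne_zero h3 hθ0)]
    have e2 : (α ^ 3) 27 = (α ^ 3) (-1) * (α ^ 3) (-27) := by rw [← map_mul]; congr 1; ring
    rw [e2, e1, mul_one, MulChar.pow_apply' _ three_ne_zero, ← map_pow]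
    congr 1; norm_num
  have hm1 : α (-1) * α (-1) = 1 := by rw [← map_mul]; simp
  rw [hη27] at B
  have h6 : (χ ^ 6) 6 = χ 27 * χ 27 * (χ ^ 3) 4 := by
    rw [MulChar.pow_apply' _ three_ne_zero, MulChar.pow_apply' _ (by norm_num), ← map_pow, ← map_pow,
      ← map_mul, ← map_mul]
    congr 1; norm_num
  rw [h6]
  generalize gaussSum χ ψ = a0 at *
  generalize gaussSum (χ * α) ψ = a1 at *
  generalize gaussSum (χ * α ^ 2) ψ = a2 at *
  generalize gaussSum (χ * α ^ 3) ψ = a3 at *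
  generalize gaussSum (χ * α ^ 4) ψ = a4 at *
  generalize gaussSum (χ * α ^ 5) ψ = a5 at *
  have B' : χ 27 * (a3 * a5 * a1) = α (-1) * (Fintype.card F * gaussSum (χ ^ 3 * α ^ 3) ψ) := by
    rw [← B]
    linear_combination (-(χ 27 * (a3 * a5 * a1))) * hm1
  calc _ = (χ ^ 3) 4 * ((χ 27 * (a0 * a2 * a4)) * (χ 27 * (a3 * a5 * a1))) := by ring
    _ = α (-1) * (Fintype.card F : ℂ) ^ 2 * ((χ ^ 3) 4 * (gaussSum (χ ^ 3) ψ * gaussSum (χ ^ 3 * α ^ 3) ψ)) := by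
      rw [A, B']; ring
    _ = _ := by rw [C]; ring

end HD

namespace HD
open Finset
set_option linter.unusedSectionVars false
variable {F : Type} [Field F] [Fintype F]

/-- the standard additive character -/
noncomputable def psi (p : ℕ) [Fact p.Prime] (F : Type) [Field F] [Fintype F] [Algebra (ZMod p) F] :
    AddChar F ℂ :=
  (ZMod.stdAddChar (N := p)).compAddMonoidHom (Algebra.trace (ZMod p) F).toAddMonoidHom

lemma gaussChar_eq (p : ℕ) [Fact p.Prime] [Algebra (ZMod p) F] (χ : MulChar F ℂ) :
    gaussChar p F χ = gaussSum χ (psi p F) := by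
  unfold gaussChar gaussSum
  apply sum_congr rfl
  intro x _
  congr 1
  have h := ZMod.stdAddChar_coe (N := p) ((Algebra.trace (ZMod p) F x).val : ℤ)
  rw [Int.cast_natCast, ZMod.natCast_zmod_val] at h
  have h2 : (psi p F) x = ZMod.stdAddChar (N := p) (Algebra.trace (ZMod p) F x) := rfl
  rw [h2, h, Int.cast_natCast]

lemma psi_prim (p : ℕ) [Fact p.Prime] [Algebra (ZMod p) F] : (psi p F).IsPrimitive := by
  apply AddChar.IsPrimitive.of_ne_one
  intro h
  have : CharP F p := charP_of_injective_algebraMap (algebraMap (ZMod p) F).injective p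
  obtain rfl : ringChar F = p := ringChar.eq F p ▸ rfl
  obtain ⟨a, ha⟩ := FiniteField.trace_to_zmod_nondegenerate F (one_ne_zero (α := F))
  have h1 : (psi (ringChar F) F) (1 * a) = 1 := by rw [h]; rfl
  apply ha
  apply ZMod.injective_stdAddChar
  rw [AddChar.map_zero_eq_one, ← h1]
  rfl

lemma jacobiS_two (A B : MulChar F ℂ) : jacobiS F ![A, B] = jacobiSum A B := by
  unfold jacobiS jacobiSum
  apply sum_nbij' (fun v => v 0) (fun x => ![x, 1 - x])
  · simp
  · intro x _; simp
  · intro v hv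
    simp only [mem_filter, mem_univ, true_and, Fin.sum_univ_two] at hv
    ext i; fin_cases i
    · simp
    · simp [← hv]
  · intro x _; simp
  · intro v hv
    simp only [mem_filter, mem_univ, true_and, Fin.sum_univ_two] at hv
    simp [← hv]

lemma jacobiS_three {ψ : AddChar F ℂ} (hψ : ψ.IsPrimitive) (A B C : MulChar F ℂ) (h : A * B * C = 1)
    (hC : C ≠ 1) :
    jacobiS F ![A, B, C] = - C (-1) * (gaussSum A ψ * gaussSum B ψ / gaussSum (A * B) ψ) := by
  have hAB : A * B = C⁻¹ := by rw [eq_inv_iff_mul_eq_one]; exact h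
  have hAB1 : A * B ≠ 1 := by rw [hAB]; simpa using hC
  have e1 : jacobiS F ![A, B, C] = ∑ s : F, ∑ x : F, A x * B (s - x) * C (1 - s) := by
    unfold jacobiS
    rw [← Fintype.sum_prod_type']
    apply sum_nbij' (fun v => (v 0 + v 1, v 0)) (fun x => ![x.2, x.1 - x.2, 1 - x.1])
    · simp
    · intro x _; simp [Fin.sum_univ_three]
    · intro v hv
      simp only [mem_filter, mem_univ, true_and, Fin.sum_univ_three] at hv
      ext i; fin_cases i
      · simp
      · simp
      · simp [← hv]
    · intro x _; simp
    · intro v hv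
      simp only [mem_filter, mem_univ, true_and, Fin.sum_univ_three] at hv
      simp [Fin.prod_univ_three, ← hv]
  have e2 : ∀ s : F, ∑ x : F, A x * B (s - x) * C (1 - s) =
      C⁻¹ s * C (1 - s) * jacobiSum A B := by
    intro s
    by_cases hs : s = 0
    · subst hs
      have : ∀ x : F, A x * B (0 - x) * C (1 - 0) = B (-1) * (A * B) x := by
        intro x
        rw [MulChar.mul_apply, zero_sub, ← neg_one_mul, map_mul]
        simp; ring
      simp_rw [this]
      rw [← mul_sum, MulChar.sum_eq_zero_of_ne_one hAB1, MulChar.map_zero]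
      simp
    · rw [← hAB, jacobiSum, mul_sum]
      symm
      apply Fintype.sum_equiv (Equiv.mulLeft₀ s hs)
      intro x
      simp only [Equiv.mulLeft₀_apply]
      rw [MulChar.mul_apply, show s - s * x = s * (1 - x) by ring, map_mul, map_mul]
      ring
  have e3 : ∑ s : F, C⁻¹ s * C (1 - s) = - C (-1) := by
    have := jacobiSum_nontrivial_inv hC
    rw [jacobiSum_comm] at this
    exact this
  rw [e1]
  simp_rw [e2]
  rw [← sum_mul, e3, jacobiSum_eq_gaussSum_mul_gaussSum_div_gaussSum card_ne hAB1 hψ]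

lemma inv_neg_one (χ : MulChar F ℂ) : χ⁻¹ (-1) = χ (-1) := by
  rw [MulChar.inv_apply']; norm_num

lemma neg_one_sq (χ : MulChar F ℂ) : χ (-1) * χ (-1) = 1 := by rw [← map_mul]; simp

lemma gBinom_eq {ψ : AddChar F ℂ} (hψ : ψ.IsPrimitive) (A B χ : MulChar F ℂ) (h : A * B⁻¹ ≠ 1) :
    gBinom F (A * χ⁻¹) (B * χ⁻¹) = B (-1) * χ (-1) / Fintype.card F *
      (gaussSum (A * χ⁻¹) ψ * gaussSum (χ * B⁻¹) ψ / gaussSum (A * B⁻¹) ψ) := by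
  have e : (B * χ⁻¹)⁻¹ = χ * B⁻¹ := by rw [mul_inv, inv_inv, mul_comm]
  have e2 : A * χ⁻¹ * (χ * B⁻¹) = A * B⁻¹ := by
    rw [mul_assoc, inv_mul_cancel_left]
  rw [gBinom, jacobiS_two, e,
    jacobiSum_eq_gaussSum_mul_gaussSum_div_gaussSum card_ne (by rwa [e2]) hψ, e2,
    MulChar.mul_apply, inv_neg_one]

noncomputable instance : Fintype (MulChar F ℂ) := Fintype.ofFinite _

lemma card_mulChar : Fintype.card (MulChar F ℂ) = Fintype.card F - 1 := by
  have := MulChar.card_eq_card_units_of_hasEnoughRootsOfUnity F ℂ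
  rw [Nat.card_eq_fintype_card, Nat.card_eq_fintype_card] at this
  rw [this, Fintype.card_eq_card_units_add_one (α := F)]; simp

lemma orderOf_gen {ω : MulChar F ℂ} (hω : ∀ χ : MulChar F ℂ, ∃ j : ℕ, χ = ω ^ j) :
    orderOf ω = Fintype.card F - 1 := by
  rw [← card_mulChar, ← Nat.card_eq_fintype_card]
  apply orderOf_eq_card_of_forall_mem_zpowers
  intro χ
  obtain ⟨j, rfl⟩ := hω χ
  exact Subgroup.npow_mem_zpowers ω j

lemma sum_chars {ω : MulChar F ℂ} (hω : ∀ χ : MulChar F ℂ, ∃ j : ℕ, χ = ω ^ j)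
    (f : MulChar F ℂ → ℂ) :
    ∑ j ∈ range (Fintype.card F - 1), f (ω ^ j) = ∑ χ : MulChar F ℂ, f χ := by
  rw [← orderOf_gen hω]
  apply sum_bij (fun j _ => ω ^ j)
  · simp
  · intro a ha b hb h
    exact pow_injOn_Iio_orderOf (by simpa using ha) (by simpa using hb) h
  · intro χ _
    obtain ⟨j, rfl⟩ := hω χ
    refine ⟨j % orderOf ω, ?_, pow_mod_orderOf _ _⟩
    rw [mem_range]
    exact Nat.mod_lt _ (MulChar.orderOf_pos ω)
  · simp

lemma greene_eq {ψ : AddChar F ℂ} (hψ : ψ.IsPrimitive) {ω : MulChar F ℂ}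
    (hω : ∀ χ : MulChar F ℂ, ∃ j : ℕ, χ = ω ^ j) (A₀ A₁ A₂ B : MulChar F ℂ) (z : F)
    (h0 : A₀ ≠ 1) (h1 : A₁ ≠ 1) (h2 : A₂ * B⁻¹ ≠ 1) :
    greeneF F ω ![A₀, A₁, A₂] ![1, B] z⁻¹ =
      (1 / ((Fintype.card F : ℂ) ^ 2 * ((Fintype.card F : ℂ) - 1))) *
      (B (-1) / (gaussSum A₀ ψ * gaussSum A₁ ψ * gaussSum (A₂ * B⁻¹) ψ)) *
      ∑ χ : MulChar F ℂ, χ (-1) * χ z * (gaussSum χ ψ ^ 2 * gaussSum (χ * B⁻¹) ψ *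
        gaussSum (A₀ * χ⁻¹) ψ * gaussSum (A₁ * χ⁻¹) ψ * gaussSum (A₂ * χ⁻¹) ψ) := by
  unfold greeneF
  rw [sum_chars hω (fun χ => gBinom F ((![A₀, A₁, A₂] : Fin 3 → MulChar F ℂ) 0 * χ) χ *
    (∏ i : Fin 2, gBinom F ((![A₀, A₁, A₂] : Fin 3 → MulChar F ℂ) i.succ * χ)
      ((![1, B] : Fin 2 → MulChar F ℂ) i * χ)) * χ z⁻¹)]
  rw [← Equiv.sum_comp (Equiv.inv (MulChar F ℂ)), mul_sum, mul_sum]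
  apply sum_congr rfl
  intro χ _
  simp only [Equiv.inv_apply, Fin.prod_univ_two]
  have e0 := gBinom_eq hψ A₀ 1 χ (by simpa using h0)
  have e1 := gBinom_eq hψ A₁ 1 χ (by simpa using h1)
  have e2 := gBinom_eq hψ A₂ B χ h2
  rw [chi_one (by simp)] at e0 e1
  simp only [one_mul, inv_one, mul_one] at e0 e1
  have hz : χ⁻¹ z⁻¹ = χ z := by rw [MulChar.inv_apply', inv_inv]
  have t0 : (![A₀, A₁, A₂] : Fin 3 → MulChar F ℂ) 0 = A₀ := rfl
  have t1 : (![A₀, A₁, A₂] : Fin 3 → MulChar F ℂ) (Fin.succ (0 : Fin 2)) = A₁ := rfl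
  have t2 : (![A₀, A₁, A₂] : Fin 3 → MulChar F ℂ) (Fin.succ (1 : Fin 2)) = A₂ := rfl
  have t3 : (![1, B] : Fin 2 → MulChar F ℂ) 0 = 1 := rfl
  have t4 : (![1, B] : Fin 2 → MulChar F ℂ) 1 = B := rfl
  rw [t0, t1, t2, t3, t4, one_mul, e0, e1, e2, hz]
  have hs := neg_one_sq χ
  have g0 := gauss_ne hψ A₀
  have g1 := gauss_ne hψ A₁
  have g2 := gauss_ne hψ (A₂ * B⁻¹)
  have hq := card_ne (F := F)
  have hq1 : (Fintype.card F : ℂ) - 1 ≠ 0 := by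
    have : 1 < Fintype.card F := Fintype.one_lt_card
    rw [sub_ne_zero]
    exact_mod_cast this.ne'
  have hs3 : χ (-1) ^ 3 = χ (-1) := by rw [pow_succ, pow_two, hs, one_mul]
  field_simp
  rw [hs3]

/-- The summand of `S` -/
noncomputable def TT (ψ : AddChar F ℂ) (α : MulChar F ℂ) (l : F) (χ : MulChar F ℂ) : ℂ :=
  gaussSum χ ψ ^ 3 * gaussSum (χ * α) ψ ^ 2 * gaussSum (χ * α ^ 4) ψ / gaussSum (χ ^ 6) ψ *
    (χ ^ 6) (6 * l)

/-- The summand of the hypergeometric function -/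
noncomputable def UU (ψ : AddChar F ℂ) (α : MulChar F ℂ) (l : F) (χ : MulChar F ℂ) : ℂ :=
  χ (-1) * χ (l ^ 6) * (gaussSum χ ψ ^ 2 * gaussSum (χ * α) ψ * gaussSum (χ * α ^ 5)⁻¹ ψ *
    gaussSum (χ * α ^ 2)⁻¹ ψ * gaussSum (χ * α ^ 3)⁻¹ ψ)

lemma gauss_inv_delta {ψ : AddChar F ℂ} (hψ : ψ.IsPrimitive) (A : MulChar F ℂ) :
    (Fintype.card F : ℂ) * A (-1) = gaussSum A ψ * gaussSum A⁻¹ ψ *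
      (if A = 1 then (Fintype.card F : ℂ) else 1) := by
  split_ifs with h
  · subst h
    rw [inv_one, gauss_one hψ, chi_one (by simp)]; ring
  · rw [gauss_mul_inv hψ h]; ring

lemma T_eq_U {ψ : AddChar F ℂ} (hψ : ψ.IsPrimitive) {θ : F} (hθ : θ ^ 2 = -3)
    (h2 : (2 : F) ≠ 0) (h3 : (3 : F) ≠ 0)
    {α : MulChar F ℂ} (ha6 : α ^ 6 = 1) (ha3 : α ^ 3 ≠ 1) (ha2 : α ^ 2 ≠ 1) (l : F)
    (χ : MulChar F ℂ) :
    TT ψ α l χ = α (-1) * gaussSum (α ^ 3) ψ / Fintype.card F * UU ψ α l χ *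
      ((if χ * α ^ 5 = 1 then (Fintype.card F : ℂ) else 1) *
      (if χ * α ^ 2 = 1 then (Fintype.card F : ℂ) else 1) *
      (if χ * α ^ 3 = 1 then (Fintype.card F : ℂ) else 1)) := by
  have H := hd6 hψ hθ h2 h3 ha6 ha3 ha2 χ
  have d5 := gauss_inv_delta hψ (χ * α ^ 5)
  have d2 := gauss_inv_delta hψ (χ * α ^ 2)
  have d3 := gauss_inv_delta hψ (χ * α ^ 3)
  have hs := neg_one_sq χ
  have hsα := neg_one_sq α
  have hsgn : (χ * α ^ 5) (-1) * (χ * α ^ 2) (-1) * (χ * α ^ 3) (-1) = χ (-1) := by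
    rw [MulChar.mul_apply, MulChar.mul_apply, MulChar.mul_apply,
      MulChar.pow_apply' _ (by norm_num), MulChar.pow_apply' _ (by norm_num),
      MulChar.pow_apply' _ (by norm_num)]
    have e1 : α (-1) ^ 2 = 1 := by rw [pow_two]; exact hsα
    have e2 : χ (-1) ^ 2 = 1 := by rw [pow_two]; exact hs
    calc _ = (χ (-1) ^ 2 * χ (-1)) * (α (-1) ^ 2) ^ 5 := by ring
      _ = _ := by rw [e1, e2]; ring
  have hl : (χ ^ 6) (6 * l) = (χ ^ 6) 6 * χ (l ^ 6) := by
    rw [map_mul, MulChar.pow_apply' _ (by norm_num) l, map_pow]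
  rw [TT, UU, hl]
  have n0 := gauss_ne hψ χ
  have n1 := gauss_ne hψ (χ * α)
  have n2 := gauss_ne hψ (χ * α ^ 2)
  have n3 := gauss_ne hψ (χ * α ^ 3)
  have n4 := gauss_ne hψ (χ * α ^ 4)
  have n5 := gauss_ne hψ (χ * α ^ 5)
  have n6 := gauss_ne hψ (χ ^ 6)
  have hq := card_ne (F := F)
  have D : (Fintype.card F : ℂ) ^ 3 * χ (-1) =
      (gaussSum (χ * α ^ 5) ψ * gaussSum (χ * α ^ 5)⁻¹ ψ *
        (if χ * α ^ 5 = 1 then (Fintype.card F : ℂ) else 1)) *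
      (gaussSum (χ * α ^ 2) ψ * gaussSum (χ * α ^ 2)⁻¹ ψ *
        (if χ * α ^ 2 = 1 then (Fintype.card F : ℂ) else 1)) *
      (gaussSum (χ * α ^ 3) ψ * gaussSum (χ * α ^ 3)⁻¹ ψ *
        (if χ * α ^ 3 = 1 then (Fintype.card F : ℂ) else 1)) := by
    calc (Fintype.card F : ℂ) ^ 3 * χ (-1) = (Fintype.card F * (χ * α ^ 5) (-1)) *
          (Fintype.card F * (χ * α ^ 2) (-1)) * (Fintype.card F * (χ * α ^ 3) (-1)) := by
            rw [← hsgn]; ring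
      _ = _ := by rw [d5, d2, d3]
  clear d5 d2 d3 hsgn hl
  generalize (if χ * α ^ 5 = 1 then (Fintype.card F : ℂ) else 1) = D5 at *
  generalize (if χ * α ^ 2 = 1 then (Fintype.card F : ℂ) else 1) = D2 at *
  generalize (if χ * α ^ 3 = 1 then (Fintype.card F : ℂ) else 1) = D3 at *
  generalize gaussSum (χ * α ^ 5)⁻¹ ψ = b5 at *
  generalize gaussSum (χ * α ^ 3)⁻¹ ψ = b3 at *
  generalize gaussSum (χ * α ^ 2)⁻¹ ψ = b2 at *
  generalize gaussSum χ ψ = a0 at *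
  generalize gaussSum (χ * α) ψ = a1 at *
  generalize gaussSum (χ * α ^ 2) ψ = a2 at *
  generalize gaussSum (χ * α ^ 3) ψ = a3 at *
  generalize gaussSum (χ * α ^ 4) ψ = a4 at *
  generalize gaussSum (χ * α ^ 5) ψ = a5 at *
  generalize gaussSum (χ ^ 6) ψ = a6 at *
  generalize gaussSum (α ^ 3) ψ = g3 at *
  generalize (χ ^ 6) 6 = c6 at *
  generalize χ (l ^ 6) = cl at *
  generalize χ (-1) = s at *
  generalize α (-1) = r at *
  generalize (Fintype.card F : ℂ) = Q at *
  rw [div_mul_eq_mul_div, div_eq_iff n6, div_mul_eq_mul_div, div_mul_eq_mul_div, div_mul_eq_mul_div,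
    eq_div_iff hq]
  apply mul_left_cancel₀ (mul_ne_zero (mul_ne_zero n2 n3) n5)
  linear_combination (Q * a0 ^ 2 * a1 * cl) * H + (r * g3 * a6 * s * cl * a0 ^ 2 * a1) * D -
    (r * g3 * a6 * cl * a0 ^ 2 * a1 * Q ^ 3) * hs

lemma T_at {ψ : AddChar F ℂ} (hψ : ψ.IsPrimitive) {α χ : MulChar F ℂ} (l : F) (hl : l ≠ 0)
    (h6 : (6 : F) ≠ 0) (hχ : χ ^ 6 = 1) :
    TT ψ α l χ = - (gaussSum χ ψ ^ 3 * gaussSum (χ * α) ψ ^ 2 * gaussSum (χ * α ^ 4) ψ) := by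
  rw [TT, hχ, gauss_one hψ, chi_one (mul_ne_zero h6 hl)]; ring

lemma class_lemma {ψ : AddChar F ℂ} (hψ : ψ.IsPrimitive) {θ : F} (hθ : θ ^ 2 = -3)
    (h2 : (2 : F) ≠ 0) (h3 : (3 : F) ≠ 0)
    {α : MulChar F ℂ} (ha6 : α ^ 6 = 1) (ha3 : α ^ 3 ≠ 1) (ha2 : α ^ 2 ≠ 1) (l : F) (hl : l ≠ 0) :
    (1 / (Fintype.card F : ℂ)) * (
      gaussSum α ψ ^ 3 * gaussSum (α ^ 2) ψ ^ 2 * gaussSum (α ^ 5) ψ +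
      gaussSum (α ^ 3) ψ ^ 3 * gaussSum (α ^ 4) ψ ^ 2 * gaussSum α ψ +
      gaussSum (α ^ 4) ψ ^ 3 * gaussSum (α ^ 5) ψ ^ 2 * gaussSum (α ^ 2) ψ) +
      ((Fintype.card F : ℂ) - 1)⁻¹ * ∑ χ : MulChar F ℂ, TT ψ α l χ =
      ((Fintype.card F : ℂ) - 1)⁻¹ * (α (-1) * gaussSum (α ^ 3) ψ / Fintype.card F) *
        ∑ χ : MulChar F ℂ, UU ψ α l χ := by
  have h6 : (6 : F) ≠ 0 := by
    have : (6 : F) = 2 * 3 := by norm_num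
    rw [this]; exact mul_ne_zero h2 h3
  have hq := card_ne (F := F)
  have hq1 : (Fintype.card F : ℂ) - 1 ≠ 0 := by
    have : 1 < Fintype.card F := Fintype.one_lt_card
    rw [sub_ne_zero]
    exact_mod_cast this.ne'
  have p : ∀ n, α ^ (n + 6) = α ^ n := fun n => by rw [pow_add, ha6, mul_one]
  have ha1 : α ≠ 1 := by rintro rfl; simp at ha2
  -- distinctness
  have n13 : α ≠ α ^ 3 := by
    intro h; apply ha2
    have : α * α ^ 2 = α * 1 := by rw [mul_one, ← pow_succ']; exact h.symm
    exact mul_left_cancel this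
  have n14 : α ≠ α ^ 4 := by
    intro h; apply ha3
    have : α * α ^ 3 = α * 1 := by rw [mul_one, ← pow_succ']; exact h.symm
    exact mul_left_cancel this
  have n34 : α ^ 3 ≠ α ^ 4 := by
    intro h; apply ha1
    have : α ^ 3 * α = α ^ 3 * 1 := by rw [mul_one, ← pow_succ]; exact h.symm
    exact mul_left_cancel this
  have c5 : ∀ χ : MulChar F ℂ, χ * α ^ 5 = 1 ↔ χ = α := by
    intro χ
    rw [mul_eq_one_iff_eq_inv]
    have : (α ^ 5)⁻¹ = α := by rw [inv_eq_iff_mul_eq_one, ← pow_succ]; exact ha6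
    rw [this]
  have c2 : ∀ χ : MulChar F ℂ, χ * α ^ 2 = 1 ↔ χ = α ^ 4 := by
    intro χ
    rw [mul_eq_one_iff_eq_inv]
    have : (α ^ 2)⁻¹ = α ^ 4 := by rw [inv_eq_iff_mul_eq_one, ← pow_add]; exact ha6
    rw [this]
  have c3 : ∀ χ : MulChar F ℂ, χ * α ^ 3 = 1 ↔ χ = α ^ 3 := by
    intro χ
    rw [mul_eq_one_iff_eq_inv]
    have : (α ^ 3)⁻¹ = α ^ 3 := by rw [inv_eq_iff_mul_eq_one, ← pow_add]; exact ha6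
    rw [this]
  set K := α (-1) * gaussSum (α ^ 3) ψ / Fintype.card F with hK
  have key : ∀ χ : MulChar F ℂ, TT ψ α l χ - K * UU ψ α l χ =
      if χ ∈ ({α, α ^ 3, α ^ 4} : Finset (MulChar F ℂ)) then
        (1 - 1 / (Fintype.card F : ℂ)) * TT ψ α l χ else 0 := by
    intro χ
    have h := T_eq_U hψ hθ h2 h3 ha6 ha3 ha2 l χ
    rw [← hK] at h
    simp only [c5, c2, c3] at h
    have aux : ∀ x y : ℂ, x = y * Fintype.card F →
        x - y = (1 - 1 / (Fintype.card F : ℂ)) * x := by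
      rintro x y rfl
      field_simp
    by_cases e1 : χ = α
    · subst e1
      rw [if_pos (by simp)]
      rw [if_pos rfl, if_neg n14, if_neg n13] at h
      apply aux
      rw [h]; ring
    by_cases e3 : χ = α ^ 3
    · rw [if_pos (by simp [e3])]
      rw [if_neg e1, if_neg (by rw [e3]; exact n34), if_pos e3] at h
      apply aux
      rw [h]; ring
    by_cases e4 : χ = α ^ 4
    · rw [if_pos (by simp [e4])]
      rw [if_neg e1, if_pos e4, if_neg e3] at h
      apply aux
      rw [h]; ring
    · rw [if_neg (by simp [e1, e3, e4])]
      rw [if_neg e1, if_neg e4, if_neg e3] at h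
      rw [h]; ring
  have tot : ∑ χ : MulChar F ℂ, TT ψ α l χ - K * ∑ χ : MulChar F ℂ, UU ψ α l χ =
      (1 - 1 / (Fintype.card F : ℂ)) * (TT ψ α l α + TT ψ α l (α ^ 3) + TT ψ α l (α ^ 4)) := by
    rw [mul_sum, ← sum_sub_distrib]
    simp_rw [key]
    rw [← sum_filter, filter_mem_eq_inter, univ_inter, ← mul_sum, sum_insert (by simp [n13, n14]),
      sum_insert (by simpa using n34), sum_singleton]
    ring
  have t1 := T_at (α := α) hψ l hl h6 ha6
  have t3 := T_at (α := α) (χ := α ^ 3) hψ l hl h6 (by rw [← pow_mul]; exact (p 12).trans ((p 6).trans ((p 0).trans (pow_zero _))))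
  have t4 := T_at (α := α) (χ := α ^ 4) hψ l hl h6 (by rw [← pow_mul]; exact (p 18).trans ((p 12).trans ((p 6).trans ((p 0).trans (pow_zero _)))))
  have m1 : α * α = α ^ 2 := (pow_two α).symm
  have m2 : α * α ^ 4 = α ^ 5 := (pow_succ' α 4).symm
  have m3 : α ^ 3 * α = α ^ 4 := (pow_succ α 3).symm
  have m4 : α ^ 3 * α ^ 4 = α := by rw [← pow_add]; exact (p 1).trans (pow_one _)
  have m5 : α ^ 4 * α = α ^ 5 := (pow_succ α 4).symm
  have m6 : α ^ 4 * α ^ 4 = α ^ 2 := by rw [← pow_add]; exact p 2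
  rw [m1, m2] at t1
  rw [m3, m4] at t3
  rw [m5, m6] at t4
  rw [t1, t3, t4, sub_eq_iff_eq_add] at tot
  rw [tot]
  field_simp
  ring

end HD

namespace HD
open Finset
variable {F : Type} [Field F] [Fintype F]

lemma NqW_zero (p : ℕ) [Algebra (ZMod p) F] (ω : MulChar F ℂ) (w : Fin 6 → ZMod 6)
    (h1 : ¬ ∀ i, w i = 0) (h2 : ¬ ∀ i, w i ≠ 0) : NqW p F ω 6 w = 0 := by
  unfold NqW
  rw [if_neg h1, if_neg h2]

lemma NqW_nz (p : ℕ) [Fact p.Prime] [Algebra (ZMod p) F] (ω : MulChar F ℂ) (w : Fin 6 → ZMod 6)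
    (m : Fin 6 → ℕ) (h1 : ¬ ∀ i, w i = 0) (h2 : ∀ i, w i ≠ 0)
    (hv : ∀ i, (w i).val = m i) :
    NqW p F ω 6 w = (1 / (Fintype.card F : ℂ)) *
      ∏ i, gaussSum ((ω ^ ((Fintype.card F - 1) / 6)) ^ m i) (psi p F) := by
  unfold NqW
  rw [if_neg h1, if_pos h2]
  simp only [gaussChar_eq, ← pow_mul, hv, mul_comm]

lemma N_first (p : ℕ) [Fact p.Prime] [Algebra (ZMod p) F] (ω α : MulChar F ℂ)
    (hα : α = ω ^ ((Fintype.card F - 1) / 6)) :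
    (∑ k ∈ range 6, NqW p F ω 6 (fun i => (![0,0,0,1,1,4] : Fin 6 → ZMod 6) i + (k : ZMod 6))) =
    (1 / (Fintype.card F : ℂ)) * (
      gaussSum α (psi p F) ^ 3 * gaussSum (α ^ 2) (psi p F) ^ 2 * gaussSum (α ^ 5) (psi p F) +
      gaussSum (α ^ 3) (psi p F) ^ 3 * gaussSum (α ^ 4) (psi p F) ^ 2 * gaussSum α (psi p F) +
      gaussSum (α ^ 4) (psi p F) ^ 3 * gaussSum (α ^ 5) (psi p F) ^ 2 *
        gaussSum (α ^ 2) (psi p F)) := by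
  subst hα
  simp only [sum_range_succ, sum_range_zero, zero_add]
  rw [NqW_zero p ω _ (by decide) (by decide),
    NqW_nz p ω _ ![1,1,1,2,2,5] (by decide) (by decide) (by decide),
    NqW_zero p ω _ (by decide) (by decide),
    NqW_nz p ω _ ![3,3,3,4,4,1] (by decide) (by decide) (by decide),
    NqW_nz p ω _ ![4,4,4,5,5,2] (by decide) (by decide) (by decide),
    NqW_zero p ω _ (by decide) (by decide)]
  generalize (ω ^ ((Fintype.card F - 1) / 6)) = α
  simp only [Fin.prod_univ_six, Matrix.cons_val, pow_one]
  ring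

lemma N_second (p : ℕ) [Fact p.Prime] [Algebra (ZMod p) F] (ω α : MulChar F ℂ)
    (hα : α = ω ^ ((Fintype.card F - 1) / 6)) :
    (∑ k ∈ range 6, NqW p F ω 6 (fun i => (![0,0,0,2,5,5] : Fin 6 → ZMod 6) i + (k : ZMod 6))) =
    (1 / (Fintype.card F : ℂ)) * (
      gaussSum (α ^ 5) (psi p F) ^ 3 * gaussSum (α ^ 4) (psi p F) ^ 2 * gaussSum α (psi p F) +
      gaussSum (α ^ 3) (psi p F) ^ 3 * gaussSum (α ^ 2) (psi p F) ^ 2 * gaussSum (α ^ 5) (psi p F) +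
      gaussSum (α ^ 2) (psi p F) ^ 3 * gaussSum α (psi p F) ^ 2 *
        gaussSum (α ^ 4) (psi p F)) := by
  subst hα
  simp only [sum_range_succ, sum_range_zero, zero_add]
  rw [NqW_zero p ω _ (by decide) (by decide),
    NqW_zero p ω _ (by decide) (by decide),
    NqW_nz p ω _ ![2,2,2,4,1,1] (by decide) (by decide) (by decide),
    NqW_nz p ω _ ![3,3,3,5,2,2] (by decide) (by decide) (by decide),
    NqW_zero p ω _ (by decide) (by decide),
    NqW_nz p ω _ ![5,5,5,1,4,4] (by decide) (by decide) (by decide)]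
  generalize (ω ^ ((Fintype.card F - 1) / 6)) = α
  simp only [Fin.prod_univ_six, Matrix.cons_val, pow_one]
  ring

lemma SW_eq (p : ℕ) [Fact p.Prime] [Algebra (ZMod p) F] {ω : MulChar F ℂ}
    (hω : ∀ χ : MulChar F ℂ, ∃ j : ℕ, χ = ω ^ j) (w : Fin 6 → ZMod 6) (l : F) :
    SW p F ω 6 (fun _ => 1) w l = ((Fintype.card F : ℂ) - 1)⁻¹ * ∑ χ : MulChar F ℂ,
      (∏ i, gaussSum (χ * (ω ^ ((Fintype.card F - 1) / 6)) ^ (w i).val) (psi p F)) /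
        gaussSum (χ ^ 6) (psi p F) * (χ ^ 6) (6 * l) := by
  unfold SW
  rw [← sum_chars hω]
  refine congrArg (fun x => ((Fintype.card F : ℂ) - 1)⁻¹ * x) ?_
  apply sum_congr rfl
  intro j _
  have e : ω ^ (6 * j) = (ω ^ j) ^ 6 := by rw [← pow_mul, mul_comm]
  have e2 : ∀ i, ω ^ ((w i).val * ((Fintype.card F - 1) / 6) + 1 * j) =
      ω ^ j * (ω ^ ((Fintype.card F - 1) / 6)) ^ (w i).val := by
    intro i
    rw [one_mul, pow_add, mul_comm, ← pow_mul, mul_comm (w i).val]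
  simp only [gaussChar_eq, e2, e]
  norm_num

lemma S_first (p : ℕ) [Fact p.Prime] [Algebra (ZMod p) F] {ω α : MulChar F ℂ}
    (hω : ∀ χ : MulChar F ℂ, ∃ j : ℕ, χ = ω ^ j)
    (hα : α = ω ^ ((Fintype.card F - 1) / 6)) (l : F) :
    SW p F ω 6 (fun _ => 1) (![0,0,0,1,1,4] : Fin 6 → ZMod 6) l =
      ((Fintype.card F : ℂ) - 1)⁻¹ * ∑ χ : MulChar F ℂ, TT (psi p F) α l χ := by
  rw [SW_eq p hω, ← hα]
  congr 1
  apply sum_congr rfl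
  intro χ _
  rw [TT, Fin.prod_univ_six]
  congr 2
  change gaussSum (χ * α ^ 0) (psi p F) * gaussSum (χ * α ^ 0) (psi p F) *
    gaussSum (χ * α ^ 0) (psi p F) * gaussSum (χ * α ^ 1) (psi p F) *
    gaussSum (χ * α ^ 1) (psi p F) * gaussSum (χ * α ^ 4) (psi p F) = _
  rw [pow_zero, pow_one, mul_one]
  ring

lemma S_second (p : ℕ) [Fact p.Prime] [Algebra (ZMod p) F] {ω α : MulChar F ℂ}
    (hω : ∀ χ : MulChar F ℂ, ∃ j : ℕ, χ = ω ^ j)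
    (hα : α = ω ^ ((Fintype.card F - 1) / 6)) (h6 : α ^ 6 = 1) (l : F) :
    SW p F ω 6 (fun _ => 1) (![0,0,0,2,5,5] : Fin 6 → ZMod 6) l =
      ((Fintype.card F : ℂ) - 1)⁻¹ * ∑ χ : MulChar F ℂ, TT (psi p F) (α ^ 5) l χ := by
  rw [SW_eq p hω, ← hα]
  congr 1
  apply sum_congr rfl
  intro χ _
  have e : (α ^ 5) ^ 4 = α ^ 2 := by
    rw [← pow_mul, show 5 * 4 = 6 * 3 + 2 by norm_num, pow_add, pow_mul, h6, one_pow, one_mul]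
  rw [TT, Fin.prod_univ_six, e]
  congr 2
  change gaussSum (χ * α ^ 0) (psi p F) * gaussSum (χ * α ^ 0) (psi p F) *
    gaussSum (χ * α ^ 0) (psi p F) * gaussSum (χ * α ^ 2) (psi p F) *
    gaussSum (χ * α ^ 5) (psi p F) * gaussSum (χ * α ^ 5) (psi p F) = _
  rw [pow_zero, mul_one]
  ring

lemma field_facts (p : ℕ) [Fact p.Prime] [Algebra (ZMod p) F]
    (hmod : Fintype.card F % 6 = 1) :
    (2 : F) ≠ 0 ∧ (3 : F) ≠ 0 ∧ ∃ θ : F, θ ^ 2 = -3 := by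
  have hc : (Fintype.card F : F) = 0 := FiniteField.cast_card_eq_zero F
  have hs : Fintype.card F = 6 * (Fintype.card F / 6) + 1 := by omega
  rw [hs] at hc
  push_cast at hc
  refine ⟨?_, ?_, ?_⟩
  · intro h
    have : (6 : F) = 2 * 3 := by norm_num
    rw [this, h] at hc
    simp at hc
  · intro h
    have : (6 : F) = 2 * 3 := by norm_num
    rw [this, h] at hc
    simp at hc
  · have : Fact (Nat.Prime 3) := ⟨by norm_num⟩
    have hu : 3 ∣ Fintype.card Fˣ := by
      have := Fintype.card_eq_card_units_add_one (α := F)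
      omega
    obtain ⟨z, hz⟩ := exists_prime_orderOf_dvd_card 3 hu
    have hz3 : (z : F) ^ 3 = 1 := by
      have := pow_orderOf_eq_one z
      rw [hz] at this
      have h := congrArg (fun u : Fˣ => (u : F)) this
      simpa using h
    have hz1 : (z : F) ≠ 1 := by
      intro h
      have : z = 1 := Units.ext h
      rw [this, orderOf_one] at hz
      omega
    refine ⟨2 * z + 1, ?_⟩
    have : (z : F) ^ 2 + z + 1 = 0 := by
      apply mul_left_cancel₀ (sub_ne_zero.2 hz1)
      linear_combination hz3
    linear_combination 4 * this

end HD

namespace HD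
open Finset
variable {F : Type} [Field F] [Fintype F]

lemma rhs_first {ψ : AddChar F ℂ} (hψ : ψ.IsPrimitive) {ω : MulChar F ℂ}
    (hω : ∀ χ : MulChar F ℂ, ∃ j : ℕ, χ = ω ^ j)
    {α : MulChar F ℂ} (ha6 : α ^ 6 = 1) (ha3 : α ^ 3 ≠ 1) (ha2 : α ^ 2 ≠ 1) (l : F) :
    (Fintype.card F : ℂ) ^ 2 * α (-1) * jacobiS F ![α, α, (α ^ 2)⁻¹] *
        jacobiS F ![α ^ 3, (α ^ 2)⁻¹, α⁻¹] *
        greeneF F ω ![α, (α ^ 2)⁻¹, α ^ 3] ![1, α⁻¹] (l ^ 6)⁻¹ =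
      ((Fintype.card F : ℂ) - 1)⁻¹ * (α (-1) * gaussSum (α ^ 3) ψ / Fintype.card F) *
        ∑ χ : MulChar F ℂ, UU ψ α l χ := by
  have ha1 : α ≠ 1 := by rintro rfl; simp at ha2
  have ha4 : α ^ 4 ≠ 1 := by
    intro h; apply ha2
    have h' : α ^ 4 * α ^ 2 = 1 := by rw [← pow_add]; exact ha6
    rwa [h, one_mul] at h'
  have i2 : (α ^ 2)⁻¹ = α ^ 4 := by rw [inv_eq_iff_mul_eq_one, ← pow_add]; exact ha6
  have i1 : α⁻¹ = α ^ 5 := by rw [inv_eq_iff_mul_eq_one, ← pow_succ']; exact ha6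
  have m34 : α ^ 3 * α ^ 4 = α := by
    rw [← pow_add, pow_succ, ha6, one_mul]
  rw [jacobiS_three hψ α α (α ^ 2)⁻¹ (by rw [← pow_two]; simp) (by simpa using ha2),
    jacobiS_three hψ (α ^ 3) (α ^ 2)⁻¹ α⁻¹ (by rw [i2, m34]; simp) (by simpa using ha1),
    greene_eq hψ hω α (α ^ 2)⁻¹ (α ^ 3) α⁻¹ (l ^ 6) ha1 (by simpa using ha2)
      (by rw [inv_inv, ← pow_succ]; exact ha4)]
  have hU : ∑ χ : MulChar F ℂ, χ (-1) * χ (l ^ 6) * (gaussSum χ ψ ^ 2 * gaussSum (χ * α⁻¹⁻¹) ψ *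
        gaussSum (α * χ⁻¹) ψ * gaussSum ((α ^ 2)⁻¹ * χ⁻¹) ψ * gaussSum (α ^ 3 * χ⁻¹) ψ) =
      ∑ χ : MulChar F ℂ, UU ψ α l χ := by
    apply sum_congr rfl
    intro χ _
    have e5 : (χ * α ^ 5)⁻¹ = α * χ⁻¹ := by rw [mul_inv_rev, ← i1, inv_inv]
    have e3 : (χ * α ^ 3)⁻¹ = α ^ 3 * χ⁻¹ := by
      have : (α ^ 3)⁻¹ = α ^ 3 := by rw [inv_eq_iff_mul_eq_one, ← pow_add]; exact ha6
      rw [mul_inv_rev, this]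
    rw [UU, e5, e3, mul_inv_rev, inv_inv]
  have m11 : α * α = α ^ 2 := (pow_two α).symm
  have m31 : α ^ 3 * α = α ^ 4 := (pow_succ α 3).symm
  rw [hU, inv_neg_one, inv_neg_one, inv_inv, m11, m31, i2, m34,
    MulChar.pow_apply' _ (by norm_num)]
  have hs := neg_one_sq α
  have g1 := gauss_ne hψ α
  have g2 := gauss_ne hψ (α ^ 2)
  have g4 := gauss_ne hψ (α ^ 4)
  have r24 := gauss_mul_inv hψ ha2
  have hs2 : α (-1) ^ 2 = 1 := by rw [pow_two]; exact hs
  rw [i2, MulChar.pow_apply' _ (by norm_num), hs2, one_mul] at r24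
  have hq := card_ne (F := F)
  have hq1 : (Fintype.card F : ℂ) - 1 ≠ 0 := by
    have : 1 < Fintype.card F := Fintype.one_lt_card
    rw [sub_ne_zero]
    exact_mod_cast this.ne'
  generalize ∑ χ : MulChar F ℂ, UU ψ α l χ = U at *
  generalize gaussSum α ψ = G1 at *
  generalize gaussSum (α ^ 2) ψ = G2 at *
  generalize gaussSum (α ^ 3) ψ = G3 at *
  generalize gaussSum (α ^ 4) ψ = G4 at *
  generalize α (-1) = s at *
  generalize (Fintype.card F : ℂ) = Q at *
  subst r24
  rw [hs2]
  field_simp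
  linear_combination (s * G3 * U) * hs2

lemma rhs_second {ψ : AddChar F ℂ} (hψ : ψ.IsPrimitive) {ω : MulChar F ℂ}
    (hω : ∀ χ : MulChar F ℂ, ∃ j : ℕ, χ = ω ^ j)
    {α : MulChar F ℂ} (ha6 : α ^ 6 = 1) (ha3 : α ^ 3 ≠ 1) (ha2 : α ^ 2 ≠ 1) (l : F) :
    (Fintype.card F : ℂ) ^ 2 * jacobiS F ![α ^ 2, α ^ 2, α ^ 2] *
        jacobiS F ![α ^ 3, (α ^ 2)⁻¹, α⁻¹] *
        greeneF F ω ![α ^ 2, α⁻¹, α ^ 3] ![1, α] (l ^ 6)⁻¹ =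
      ((Fintype.card F : ℂ) - 1)⁻¹ * (α (-1) * gaussSum (α ^ 3) ψ / Fintype.card F) *
        ∑ χ : MulChar F ℂ, UU ψ (α ^ 5) l χ := by
  have ha1 : α ≠ 1 := by rintro rfl; simp at ha2
  have i2 : (α ^ 2)⁻¹ = α ^ 4 := by rw [inv_eq_iff_mul_eq_one, ← pow_add]; exact ha6
  have i1 : α⁻¹ = α ^ 5 := by rw [inv_eq_iff_mul_eq_one, ← pow_succ']; exact ha6
  have i3 : (α ^ 3)⁻¹ = α ^ 3 := by rw [inv_eq_iff_mul_eq_one, ← pow_add]; exact ha6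
  have m34 : α ^ 3 * α ^ 4 = α := by
    rw [← pow_add, pow_succ, ha6, one_mul]
  have m31 : α ^ 3 * α⁻¹ = α ^ 2 := by
    rw [mul_inv_eq_iff_eq_mul, ← pow_succ]
  rw [jacobiS_three hψ (α ^ 2) (α ^ 2) (α ^ 2) (by rw [← pow_add, ← pow_add]; exact ha6) ha2,
    jacobiS_three hψ (α ^ 3) (α ^ 2)⁻¹ α⁻¹ (by rw [i2, m34]; simp) (by simpa using ha1),
    greene_eq hψ hω (α ^ 2) α⁻¹ (α ^ 3) α (l ^ 6) ha2 (by simpa using ha1)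
      (by rw [m31]; exact ha2)]
  have hU : ∑ χ : MulChar F ℂ, χ (-1) * χ (l ^ 6) * (gaussSum χ ψ ^ 2 * gaussSum (χ * α⁻¹) ψ *
        gaussSum (α ^ 2 * χ⁻¹) ψ * gaussSum (α⁻¹ * χ⁻¹) ψ * gaussSum (α ^ 3 * χ⁻¹) ψ) =
      ∑ χ : MulChar F ℂ, UU ψ (α ^ 5) l χ := by
    apply sum_congr rfl
    intro χ _
    have e5 : (χ * (α ^ 5) ^ 5)⁻¹ = α⁻¹ * χ⁻¹ := by rw [mul_inv_rev, ← i1, inv_pow, ← i1, inv_inv]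
    have e3 : (χ * (α ^ 5) ^ 3)⁻¹ = α ^ 3 * χ⁻¹ := by
      rw [mul_inv_rev, ← i1, inv_pow, inv_inv]
    have e2 : (χ * (α ^ 5) ^ 2)⁻¹ = α ^ 2 * χ⁻¹ := by
      rw [mul_inv_rev, ← i1, inv_pow, inv_inv]
    rw [UU, e5, e3, e2, i1]
    ring
  rw [hU, inv_neg_one, m31, i2, m34, ← pow_add, MulChar.pow_apply' _ (by norm_num)]
  have hs := neg_one_sq α
  have g1 := gauss_ne hψ α
  have g2 := gauss_ne hψ (α ^ 2)
  have g4 := gauss_ne hψ (α ^ (2 + 2))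
  have g5 := gauss_ne hψ α⁻¹
  have r15 := gauss_mul_inv hψ ha1
  have hq := card_ne (F := F)
  have hq1 : (Fintype.card F : ℂ) - 1 ≠ 0 := by
    have : 1 < Fintype.card F := Fintype.one_lt_card
    rw [sub_ne_zero]
    exact_mod_cast this.ne'
  have hs2 : α (-1) ^ 2 = 1 := by rw [pow_two]; exact hs
  change _ * (_ * (_ / gaussSum (α ^ 4) ψ)) * _ * _ = _
  generalize ∑ χ : MulChar F ℂ, UU ψ (α ^ 5) l χ = U at *
  generalize gaussSum α⁻¹ ψ = G5 at *
  generalize gaussSum α ψ = G1 at *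
  generalize gaussSum (α ^ 2) ψ = G2 at *
  generalize gaussSum (α ^ 3) ψ = G3 at *
  change gaussSum (α ^ 4) ψ ≠ 0 at g4
  generalize gaussSum (α ^ 4) ψ = G4 at *
  generalize α (-1) = s at *
  generalize (Fintype.card F : ℂ) = Q at *
  have hs0 : s ≠ 0 := by rintro rfl; simp at hs
  have r : Q = s * (G1 * G5) := by rw [r15]; linear_combination -Q * hs2
  subst r
  rw [hs2]
  field_simp
  rw [hs2, one_mul]

end HD

/-- The combined contribution of the classes of `w = (0,0,0,1,1,4)` and `w = (0,0,0,2,5,5)`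
in Koblitz's formula. -/
theorem class_000114_000255 (p e q t : ℕ) [Fact p.Prime] (F : Type) [Field F] [Fintype F]
    [Algebra (ZMod p) F]
    (he : 0 < e) (hq : q = Fintype.card F) (hqe : q = p ^ e) (hmod : q % 6 = 1)
    (ht : t = (q - 1) / 6)
    (ω : MulChar F ℂ) (hω : ∀ χ : MulChar F ℂ, ∃ j : ℕ, χ = ω ^ j)
    (ω₆ ω₃ ω₂ : MulChar F ℂ)
    (hω₆ : ω₆ = ω ^ t) (hω₃ : ω₃ = ω ^ (2 * t)) (hω₂ : ω₂ = ω ^ (3 * t))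
    (lam : F) (hlam : lam ≠ 0) (hlam6 : lam ^ 6 ≠ 1) :
    (∑ k ∈ Finset.range 6, NqW p F ω 6 (fun i => (![0,0,0,1,1,4] : Fin 6 → ZMod 6) i + (k : ZMod 6))) +
      SW p F ω 6 (fun _ => 1) (![0,0,0,1,1,4] : Fin 6 → ZMod 6) lam +
      ((∑ k ∈ Finset.range 6, NqW p F ω 6 (fun i => (![0,0,0,2,5,5] : Fin 6 → ZMod 6) i + (k : ZMod 6))) +
      SW p F ω 6 (fun _ => 1) (![0,0,0,2,5,5] : Fin 6 → ZMod 6) lam) =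
      (q : ℂ) ^ 2 * ω₆ (-1) * jacobiS F ![ω₆, ω₆, ω₃⁻¹] * jacobiS F ![ω₂, ω₃⁻¹, ω₆⁻¹] *
          greeneF F ω ![ω₆, ω₃⁻¹, ω₂] ![1, ω₆⁻¹] (lam ^ 6)⁻¹ +
        (q : ℂ) ^ 2 * jacobiS F ![ω₃, ω₃, ω₃] * jacobiS F ![ω₂, ω₃⁻¹, ω₆⁻¹] *
          greeneF F ω ![ω₃, ω₆⁻¹, ω₂] ![1, ω₆] (lam ^ 6)⁻¹ := by
  subst hq
  have hψ := HD.psi_prim (F := F) p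
  obtain ⟨h2, h3, θ, hθ⟩ := HD.field_facts (F := F) p hmod
  have hα : ω₆ = ω ^ ((Fintype.card F - 1) / 6) := by rw [hω₆, ht]
  have hord := HD.orderOf_gen hω
  have hcard : 1 < Fintype.card F := Fintype.one_lt_card
  have e3 : ω₃ = ω₆ ^ 2 := by rw [hω₃, hω₆, ← pow_mul, mul_comm]
  have e2 : ω₂ = ω₆ ^ 3 := by rw [hω₂, hω₆, ← pow_mul, mul_comm]
  have h6t : 6 * t = Fintype.card F - 1 := by omega
  have ha6 : ω₆ ^ 6 = 1 := by
    rw [hω₆, ← pow_mul, mul_comm, h6t, ← hord, pow_orderOf_eq_one]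
  have hne : ∀ m, 0 < m → m < 6 → ω₆ ^ m ≠ 1 := by
    intro m hm0 hm6 h
    rw [hω₆, ← pow_mul] at h
    have hd := orderOf_dvd_of_pow_eq_one h
    rw [hord, ← h6t, mul_comm] at hd
    have := Nat.le_of_dvd (Nat.mul_pos (by omega) hm0) hd
    have htp : 0 < t := by omega
    have := Nat.le_of_mul_le_mul_left this htp
    omega
  have ha2 := hne 2 (by norm_num) (by norm_num)
  have ha3 := hne 3 (by norm_num) (by norm_num)
  have red : ∀ a b, ω₆ ^ (6 * a + b) = ω₆ ^ b := by
    intro a b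
    rw [pow_add, pow_mul, ha6, one_pow, one_mul]
  have p2 : (ω₆ ^ 5) ^ 2 = ω₆ ^ 4 := by rw [← pow_mul]; exact red 1 4
  have p3 : (ω₆ ^ 5) ^ 3 = ω₆ ^ 3 := by rw [← pow_mul]; exact red 2 3
  have p4 : (ω₆ ^ 5) ^ 4 = ω₆ ^ 2 := by rw [← pow_mul]; exact red 3 2
  have p5 : (ω₆ ^ 5) ^ 5 = ω₆ := by rw [← pow_mul]; exact (red 4 1).trans (pow_one _)
  have p6 : (ω₆ ^ 5) ^ 6 = 1 := by rw [← pow_mul, mul_comm, pow_mul, ha6, one_pow]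
  have s5 : (ω₆ ^ 5) (-1) = ω₆ (-1) := by
    have hs : ω₆ (-1) ^ 2 = 1 := by rw [pow_two]; exact HD.neg_one_sq ω₆
    rw [MulChar.pow_apply' _ (by norm_num)]
    calc ω₆ (-1) ^ 5 = (ω₆ (-1) ^ 2) ^ 2 * ω₆ (-1) := by ring
      _ = _ := by rw [hs]; ring
  have C1 := HD.class_lemma hψ hθ h2 h3 ha6 ha3 ha2 lam hlam
  have C2 := HD.class_lemma (α := ω₆ ^ 5) hψ hθ h2 h3 p6 (by rw [p3]; exact ha3)
    (by rw [p2]; exact hne 4 (by norm_num) (by norm_num)) lam hlam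
  rw [p2, p3, p4, p5, s5] at C2
  rw [e3, e2, HD.rhs_first hψ hω ha6 ha3 ha2 lam, HD.rhs_second hψ hω ha6 ha3 ha2 lam,
    HD.N_first p ω ω₆ hα, HD.N_second p ω ω₆ hα, HD.S_first p hω hα, HD.S_second p hω hα ha6,
    C1, C2]
end

section
/- Let q = p^e be a power of a prime with q ≡ 1 (mod 6), t = (q-1)/6, ω₆ = ω^t, ω₃ = ω^{2t}, ω₂ = ω^{3t}, and let λ ∈ 𝔽_q with λ ≠ 0 and λ⁶ ≠ 1. For the equivalence class of w = (0,0,0,1,2,3): Σ_{w'∈[0,0,0,1,2,3]} N_q(0,w') + S_{[0,0,0,1,2,3]} = −q²·J(ω₆,ω₃,ω₂)·₂F₁(ω₆,ω₃; ε | 1/λ⁶)_q. -/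
open scoped Classical

set_option linter.unusedSectionVars false

namespace HDProof

variable {F : Type} [Field F] [Fintype F]

noncomputable instance instFT : Fintype (MulChar F ℂ) := Fintype.ofFinite _

lemma card_chars : (Fintype.card (MulChar F ℂ) : ℂ) = (Fintype.card F : ℂ) - 1 := by
  have h := MulChar.card_eq_card_units_of_hasEnoughRootsOfUnity F ℂ
  rw [Nat.card_eq_fintype_card, Nat.card_eq_fintype_card, Fintype.card_units] at h
  rw [h, Nat.cast_sub Fintype.card_pos, Nat.cast_one]

lemma gen_order (ω : MulChar F ℂ) (hω : ∀ χ : MulChar F ℂ, ∃ j : ℕ, χ = ω ^ j) :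
    orderOf ω = Fintype.card F - 1 := by
  have h := MulChar.card_eq_card_units_of_hasEnoughRootsOfUnity F ℂ
  rw [Nat.card_eq_fintype_card (α := Fˣ), Fintype.card_units] at h
  rw [← h]
  apply orderOf_eq_card_of_forall_mem_zpowers
  intro χ
  obtain ⟨j, rfl⟩ := hω χ
  exact ⟨j, by simp⟩

lemma sum_range_eq (ω : MulChar F ℂ) (hω : ∀ χ : MulChar F ℂ, ∃ j : ℕ, χ = ω ^ j)
    (f : MulChar F ℂ → ℂ) :
    ∑ j ∈ Finset.range (Fintype.card F - 1), f (ω ^ j) = ∑ χ, f χ := by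
  have ho := gen_order ω hω
  have hpos : 0 < orderOf ω := orderOf_pos ω
  refine Finset.sum_bij (fun j _ => ω ^ j) (fun _ _ => Finset.mem_univ _) ?_ ?_ (fun _ _ => rfl)
  · intro a ha b hb hab
    rw [Finset.mem_range, ← ho] at ha hb
    exact pow_injOn_Iio_orderOf ha hb hab
  · intro χ _
    obtain ⟨j, rfl⟩ := hω χ
    refine ⟨j % orderOf ω, ?_, pow_mod_orderOf ω j⟩
    rw [Finset.mem_range, ← ho]
    exact Nat.mod_lt _ hpos

lemma orth (a : F) : ∑ χ : MulChar F ℂ, χ a = if a = 1 then (Fintype.card F : ℂ) - 1 else 0 := by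
  split_ifs with h
  · subst h
    simp [card_chars]
  · obtain ⟨η, hη⟩ := MulChar.exists_apply_ne_one_of_hasEnoughRootsOfUnity F ℂ h
    refine eq_zero_of_mul_eq_self_left hη ?_
    rw [Finset.mul_sum]
    exact Fintype.sum_equiv (Equiv.mulLeft η) _ _ (fun χ => by simp [MulChar.mul_apply])

lemma exists_gen : ∃ g : Fˣ, ∀ x, x ∈ Subgroup.zpowers g := IsCyclic.exists_generator

lemma chars_sq {χ φ : MulChar F ℂ} (hφ : φ ≠ 1) (hφ2 : φ ^ 2 = 1) (h : χ ^ 2 = 1) :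
    χ = 1 ∨ χ = φ := by
  obtain ⟨g, hg⟩ := exists_gen (F := F)
  have key : ∀ η : MulChar F ℂ, η ^ 2 = 1 → η g = 1 ∨ η g = -1 := by
    intro η hη
    have := congrArg (fun c : MulChar F ℂ => c g) hη
    simp only [MulChar.pow_apply_coe, MulChar.one_apply_coe] at this
    exact sq_eq_one_iff.mp this
  have h1 : φ g ≠ 1 := fun hh => hφ ((MulChar.eq_iff hg _ _).2 (by simpa using hh))
  rcases key χ h with h | h
  · left; exact (MulChar.eq_iff hg _ _).2 (by simpa using h)
  · right
    refine (MulChar.eq_iff hg _ _).2 ?_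
    rw [h, (key φ hφ2).resolve_left h1]

lemma chars_cube {χ ρ : MulChar F ℂ} (hρ : ρ ≠ 1) (hρ3 : ρ ^ 3 = 1) (h : χ ^ 3 = 1) :
    χ = 1 ∨ χ = ρ ∨ χ = ρ ^ 2 := by
  obtain ⟨g, hg⟩ := exists_gen (F := F)
  have key : ∀ η : MulChar F ℂ, η ^ 3 = 1 → η g ^ 3 = 1 := by
    intro η hη
    have := congrArg (fun c : MulChar F ℂ => c g) hη
    simpa only [MulChar.pow_apply_coe, MulChar.one_apply_coe] using this
  have h1 : ρ g ≠ 1 := fun hh => hρ ((MulChar.eq_iff hg _ _).2 (by simpa using hh))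
  have h2 := key ρ hρ3
  have h3 := key χ h
  have h4 : ρ g ^ 2 + ρ g + 1 = 0 := by
    have : (ρ g - 1) * (ρ g ^ 2 + ρ g + 1) = 0 := by linear_combination h2
    exact (mul_eq_zero.mp this).resolve_left (sub_ne_zero.2 h1)
  have h5 : (χ g - 1) * ((χ g - ρ g) * (χ g - ρ g ^ 2)) = 0 := by
    linear_combination h3 - h2 + (- χ g ^ 2 + χ g * ρ g) * h4
  rw [MulChar.eq_iff hg, MulChar.eq_iff hg, MulChar.eq_iff hg, MulChar.pow_apply_coe,
    MulChar.one_apply_coe]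
  rcases mul_eq_zero.mp h5 with h | h
  · exact Or.inl (sub_eq_zero.mp h)
  rcases mul_eq_zero.mp h with h | h
  · exact Or.inr (Or.inl (sub_eq_zero.mp h))
  · exact Or.inr (Or.inr (sub_eq_zero.mp h))

variable {ψ : AddChar F ℂ}

lemma qne : (Fintype.card F : ℂ) ≠ 0 := by
  exact_mod_cast Fintype.card_ne_zero

lemma g_one (hψ : ψ.IsPrimitive) : gaussSum (1 : MulChar F ℂ) ψ = -1 :=
  gaussSum_one_left (by
    have := hψ (one_ne_zero)
    simpa [AddChar.mulShift_one] using this)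

lemma g_inv (hψ : ψ.IsPrimitive) {χ : MulChar F ℂ} (hχ : χ ≠ 1) :
    gaussSum χ ψ * gaussSum χ⁻¹ ψ = χ (-1) * Fintype.card F := by
  rw [← gaussSum_mul_gaussSum_eq_card hχ hψ, ← mul_gaussSum_inv_eq_gaussSum χ⁻¹ ψ]
  have : χ⁻¹ (-1) = χ (-1) := by rw [MulChar.inv_apply']; simp
  rw [this]; ring

lemma g_ne (hψ : ψ.IsPrimitive) (χ : MulChar F ℂ) : gaussSum χ ψ ≠ 0 := by
  by_cases h : χ = 1
  · subst h; rw [g_one hψ]; simp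
  · exact gaussSum_ne_zero_of_nontrivial qne h hψ

lemma g_norm (hψ : ψ.IsPrimitive) {χ : MulChar F ℂ} (hχ : χ ≠ 1) :
    ‖gaussSum χ ψ‖ ^ 2 = Fintype.card F := by
  have h := gaussSum_mul_gaussSum_eq_card hχ hψ
  rw [← star_gaussSum_eq] at h
  have h2 := congrArg (fun z : ℂ => ‖z‖) h
  simp only [norm_mul, norm_star, Complex.norm_natCast] at h2
  rw [sq]; exact h2

lemma neg_one_sq (χ : MulChar F ℂ) : χ (-1) ^ 2 = 1 := by
  rw [← map_pow]; simp

lemma two_ne (h2 : ringChar F ≠ 2) : (2 : F) ≠ 0 := Ring.two_ne_zero h2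

/-- duplication formula -/
lemma HD2 (h2 : ringChar F ≠ 2) (hψ : ψ.IsPrimitive) {φ : MulChar F ℂ} (hφ : φ ≠ 1)
    (hφ2 : φ ^ 2 = 1) (χ : MulChar F ℂ) :
    χ 4 * gaussSum χ ψ * gaussSum (χ * φ) ψ = gaussSum (χ ^ 2) ψ * gaussSum φ ψ := by
  have t2 := two_ne h2
  have e4 : (4 : F) = 2 ^ 2 := by norm_num
  by_cases hχ2 : χ ^ 2 = 1
  · have h4 : χ 4 = 1 := by
      rw [e4, map_pow, ← MulChar.pow_apply' _ two_ne_zero, hχ2, MulChar.one_apply t2.isUnit]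
    rw [h4, hχ2]
    rcases chars_sq hφ hφ2 hχ2 with rfl | rfl
    · simp
    · rw [← sq, hφ2]; ring
  · have hχ : χ ≠ 1 := by rintro rfl; simp at hχ2
    have hχφ : χ * φ ≠ 1 := by
      intro h
      apply hχ2
      have := congrArg (· ^ 2) h
      simpa [mul_pow, hφ2] using this
    have J1 := jacobiSum_mul_nontrivial (χ := χ) (φ := χ) (by rwa [← sq]) ψ
    have J2 := jacobiSum_mul_nontrivial hχφ ψ
    have hq : φ = (quadraticChar F).ringHomComp (Int.castRingHom ℂ) := by
      have a1 : ((quadraticChar F).ringHomComp (Int.castRingHom ℂ)) ≠ 1 :=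
        (MulChar.ringHomComp_ne_one_iff (Int.castRingHom ℂ).injective_int).mpr
          (quadraticChar_ne_one h2)
      have a2 : ((quadraticChar F).ringHomComp (Int.castRingHom ℂ)) ^ 2 = 1 := by
        rw [sq, ← MulChar.ringHomComp_mul, ← sq, (quadraticChar_isQuadratic F).sq_eq_one,
          MulChar.ringHomComp_one]
      exact ((chars_sq hφ hφ2 a2).resolve_left a1).symm
    have key : χ 4 * jacobiSum χ χ = jacobiSum χ φ := by
      have s1 : χ 4 * jacobiSum χ χ = ∑ u : F, χ (1 - u ^ 2) := by
        rw [jacobiSum, Finset.mul_sum]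
        refine Fintype.sum_equiv ((Equiv.mulLeft₀ 2 t2).trans (Equiv.subRight 1)) _ _ ?_
        intro x
        rw [← map_mul, ← map_mul]
        congr 1
        simp only [Equiv.trans_apply, Equiv.subRight_apply, Equiv.mulLeft₀_apply]
        ring
      have s2 : ∑ u : F, χ (1 - u ^ 2) = ∑ s : F, χ (1 - s) * (φ s + 1) := by
        rw [← Finset.sum_fiberwise (Finset.univ) (fun u : F => u ^ 2)]
        refine Finset.sum_congr rfl fun s _ => ?_
        have hc := quadraticChar_card_sqrts h2 s
        have hc' : (((Finset.univ.filter (fun x : F => x ^ 2 = s)).card : ℕ) : ℂ) = φ s + 1 := by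
          have e : (Finset.univ.filter (fun x : F => x ^ 2 = s)) = {x : F | x ^ 2 = s}.toFinset := by
            ext; simp
          rw [e, hq]
          have := congrArg (fun z : ℤ => (z : ℂ)) hc
          simp only [Int.cast_natCast, Int.cast_add, Int.cast_one] at this
          rw [MulChar.ringHomComp_apply]
          simpa using this
        rw [← hc']
        rw [Finset.sum_congr rfl (g := fun _ => χ (1 - s))]
        · rw [Finset.sum_const, nsmul_eq_mul, mul_comm]
        · intro x hx
          rw [(Finset.mem_filter.mp hx).2]
      rw [s1, s2, jacobiSum_comm, jacobiSum]
      have s3 : ∑ s : F, χ (1 - s) = 0 := by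
        rw [← MulChar.sum_eq_zero_of_ne_one hχ]
        exact Fintype.sum_equiv (Equiv.subLeft 1) _ _ (fun x => rfl)
      simp only [mul_add, mul_one, Finset.sum_add_distrib, s3, add_zero]
      exact Finset.sum_congr rfl fun _ _ => mul_comm _ _
    rw [← sq] at J1
    have gn := g_ne hψ χ
    apply mul_left_cancel₀ gn
    linear_combination (-χ 4 * gaussSum (χ * φ) ψ) * J1 + gaussSum (χ ^ 2) ψ * J2 +
      gaussSum (χ * φ) ψ * gaussSum (χ ^ 2) ψ * key

/-- three-fold Jacobi sum -/
noncomputable def J3 (α β γ : MulChar F ℂ) : ℂ := ∑ x : F, ∑ y : F, α x * β y * γ (1 - x - y)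

lemma triple (ψ : AddChar F ℂ) (α β γ : MulChar F ℂ) :
    ∃ B0 : ℂ, gaussSum α ψ * gaussSum β ψ * gaussSum γ ψ =
        B0 + J3 α β γ * gaussSum (α * β * γ) ψ ∧
      (∑ x, α x) * (∑ x, β x) * (∑ x, γ x) = B0 + J3 α β γ * ∑ x, (α * β * γ) x ∧
      (α * β * γ ≠ 1 → B0 = 0) := by
  set B : F → ℂ := fun s => ∑ x : F, ∑ y : F, α x * β y * γ (s - x - y) with hB
  have scale : ∀ u : F, u ≠ 0 → ∀ s, B (u * s) = (α * β * γ) u * B s := by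
    intro u hu s
    simp only [hB]
    rw [Finset.mul_sum]
    refine (Fintype.sum_equiv (Equiv.mulLeft₀ u hu) _ _ fun x => ?_).symm
    rw [Finset.mul_sum]
    refine Fintype.sum_equiv (Equiv.mulLeft₀ u hu) _ _ fun y => ?_
    simp only [Equiv.mulLeft₀_apply, MulChar.mul_apply]
    rw [← mul_sub, ← mul_sub, map_mul, map_mul, map_mul]
    ring
  have gen : ∀ f : F → ℂ, (∀ a b, f (a + b) = f a * f b) →
      (∑ x, α x * f x) * (∑ x, β x * f x) * (∑ x, γ x * f x) = ∑ s, B s * f s := by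
    intro f hf
    simp only [hB]
    have l : (∑ x, α x * f x) * (∑ x, β x * f x) * (∑ x, γ x * f x) =
        ∑ x, ∑ y, ∑ z, (α x * f x) * (β y * f y) * (γ z * f z) := by
      rw [Finset.sum_mul_sum, Finset.sum_mul]
      refine Finset.sum_congr rfl fun x _ => ?_
      rw [Finset.sum_mul]
      refine Finset.sum_congr rfl fun y _ => ?_
      rw [Finset.mul_sum]
    have r : ∑ s, (∑ x, ∑ y, α x * β y * γ (s - x - y)) * f s =
        ∑ x, ∑ y, ∑ s, α x * β y * γ (s - x - y) * f s := by
      simp only [Finset.sum_mul]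
      rw [Finset.sum_comm]
      refine Finset.sum_congr rfl fun x _ => ?_
      rw [Finset.sum_comm]
    rw [l, r]
    refine Finset.sum_congr rfl fun x _ => Finset.sum_congr rfl fun y _ => ?_
    refine Fintype.sum_equiv (Equiv.addLeft (x + y)) _ _ fun z => ?_
    simp only [Equiv.coe_addLeft]
    rw [hf, hf, show x + y + z - x - y = z by ring]
    ring
  have gen2 : ∀ f : F → ℂ, f 0 = 1 → ∑ s, B s * f s = B 0 + J3 α β γ * ∑ s, (α * β * γ) s * f s := by
    intro f hf
    have hz : ∀ s, B s * f s = (if s = 0 then B 0 else 0) + J3 α β γ * ((α * β * γ) s * f s) := by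
      intro s
      by_cases hs : s = 0
      · subst hs; rw [MulChar.map_zero]; simp [hf]
      · have := scale s hs 1
        rw [mul_one] at this
        rw [this, if_neg hs]
        simp only [hB, J3]; ring
    rw [Finset.sum_congr rfl fun s _ => hz s, Finset.sum_add_distrib, ← Finset.mul_sum]
    simp
  refine ⟨B 0, ?_, ?_, ?_⟩
  · have := gen ψ (fun a b => AddChar.map_add_eq_mul ψ a b)
    rw [gen2 ψ (AddChar.map_zero_eq_one ψ)] at this
    exact this
  · have := gen (fun _ => 1) (by simp)
    rw [gen2 _ rfl] at this
    simpa using this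
  · intro h
    rcases MulChar.ne_one_iff.mp h with ⟨b, hb⟩
    have := scale b b.ne_zero 0
    rw [mul_zero] at this
    exact eq_zero_of_mul_eq_self_left hb this.symm



lemma J3_nontriv {α β γ : MulChar F ℂ} (h : α * β * γ ≠ 1) :
    gaussSum α ψ * gaussSum β ψ * gaussSum γ ψ = J3 α β γ * gaussSum (α * β * γ) ψ := by
  obtain ⟨B, h1, -, h3⟩ := triple ψ α β γ
  rw [h1, h3 h, zero_add]

lemma J3_triv (hψ : ψ.IsPrimitive) {α β γ : MulChar F ℂ} (h : α * β * γ = 1) (hβ : β ≠ 1) :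
    gaussSum α ψ * gaussSum β ψ * gaussSum γ ψ = - Fintype.card F * J3 α β γ := by
  obtain ⟨B, h1, h2, -⟩ := triple ψ α β γ
  rw [MulChar.sum_eq_zero_of_ne_one hβ, h, MulChar.sum_one_eq_card_units, Fintype.card_units,
    Nat.cast_sub Fintype.card_pos, Nat.cast_one] at h2
  rw [h1, h, g_one hψ]
  linear_combination -h2

lemma three_ne (h3 : ringChar F ≠ 3) : (3 : F) ≠ 0 := by
  intro h
  have : ((3 : ℕ) : F) = 0 := by exact_mod_cast h
  rw [ringChar.spec] at this
  rcases (Nat.dvd_prime Nat.prime_three).mp this with h | h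
  · have := (ringChar.spec F 1).2 (by rw [h])
    simp at this
  · exact h3 h

/-- points of the nodal cubic -/
lemma cube_term (h3 : (3 : F) ≠ 0) {ρ : MulChar F ℂ} (hρ3 : ρ ^ 3 = 1) (x y : F)
    (h : 27 * x * y * (1 - x - y) = 1) : ρ y * (ρ ^ 2) (1 - x - y) = 1 := by
  have hc : ∀ a : F, a ≠ 0 → ρ a ^ 3 = 1 := by
    intro a ha
    rw [← MulChar.pow_apply' _ three_ne_zero, hρ3, MulChar.one_apply ha.isUnit]
  set z := 1 - x - y with hz
  have hx : x = 1 - y - z := by rw [hz]; ring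
  have hy0 : y ≠ 0 := by rintro rfl; simp at h
  have hz0 : z ≠ 0 := by intro h0; rw [h0] at h; simp at h
  rw [MulChar.pow_apply' _ two_ne_zero]
  by_cases h1 : 3 * z - 1 = 0
  · have : (3 * y - 1) ^ 2 = 0 := by
      rw [hx] at h
      linear_combination (-1 : F) * h + (9 * y * (1 - y - z) - 3 * y) * h1
    have h2 : 3 * y - 1 = 0 := by simpa using this
    have : y = z := by
      apply mul_left_cancel₀ h3
      linear_combination h2 - h1
    rw [← this, ← hc y hy0]; ring
  · have e : (3 * y - 1) ^ 3 * z = y * (3 * z - 1) ^ 3 := by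
      rw [hx] at h
      linear_combination (z - y) * h
    have h2 : 3 * y - 1 ≠ 0 := by
      intro h0
      rw [h0] at e
      have : y * (3 * z - 1) ^ 3 = 0 := by rw [← e]; ring
      rcases mul_eq_zero.mp this with h | h
      · exact hy0 h
      · exact h1 (by simpa using h)
    have e2 := congrArg ρ e
    rw [map_mul, map_mul, map_pow, map_pow, hc _ h1, hc _ h2] at e2
    rw [← hc z hz0]
    linear_combination (-ρ z ^ 2) * e2

lemma card_points (h3 : (3 : F) ≠ 0) : Fintype.card F ≤
    (Finset.univ.filter (fun p : F × F => 27 * p.1 * p.2 * (1 - p.1 - p.2) = 1)).card + 3 := by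
  open Polynomial in
  let P : F[X] := X * (X + 1) * (X ^ 2 + X + 1)
  have hdeg : P.natDegree ≤ 4 := by
    simp only [P]; compute_degree
  have hP : P ≠ 0 := by
    intro h
    have h1 : P.coeff 4 = 0 := by rw [h]; simp
    have h2 : P = Polynomial.X ^ 4 + 2 * Polynomial.X ^ 3 + 2 * Polynomial.X ^ 2 + Polynomial.X := by
      simp only [P]; ring
    rw [h2] at h1
    have : (Polynomial.X ^ 4 + 2 * Polynomial.X ^ 3 + 2 * Polynomial.X ^ 2 + Polynomial.X :
      Polynomial F).coeff 4 = 1 := by compute_degree!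
    rw [this] at h1
    exact one_ne_zero h1
  have hR : P.roots.toFinset.card ≤ 4 :=
    (Multiset.toFinset_card_le _).trans ((Polynomial.card_roots' P).trans hdeg)
  set A : Finset F := Finset.univ \ P.roots.toFinset with hA
  have hAcard : Fintype.card F ≤ A.card + 4 := by
    have : A.card = Fintype.card F - P.roots.toFinset.card := by
      rw [hA, Finset.card_sdiff_of_subset (Finset.subset_univ _), Finset.card_univ]
    omega
  have hmem : ∀ v ∈ A, v ≠ 0 ∧ v + 1 ≠ 0 ∧ v ^ 2 + v + 1 ≠ 0 := by
    intro v hv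
    simp only [hA, Finset.mem_sdiff, Finset.mem_univ, true_and, Multiset.mem_toFinset,
      Polynomial.mem_roots hP, Polynomial.IsRoot, P] at hv
    simpa [not_or, and_assoc] using hv
  let f : F → F × F := fun v => ((1 + v) ^ 2 / (3 * v), - v ^ 2 / (3 * (v + 1)))
  have hz : ∀ v ∈ A, 1 - (f v).1 - (f v).2 = -1 / (3 * v * (v + 1)) := by
    intro v hv
    obtain ⟨a, b, c⟩ := hmem v hv
    simp only [f]
    field_simp
    ring
  have hinj : Set.InjOn f A := by
    have key : ∀ v ∈ A, (3 * (f v).2 - 1) = v * (3 * (1 - (f v).1 - (f v).2) - 1) ∧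
        (3 * (1 - (f v).1 - (f v).2) - 1) ≠ 0 := by
      intro v hv
      rw [hz v hv]
      obtain ⟨a, b, c⟩ := hmem v hv
      constructor
      · simp only [f]
        field_simp
        ring
      · intro h
        apply c
        field_simp at h
        linear_combination -h
    intro v hv w hw hvw
    obtain ⟨h1, h2⟩ := key v hv
    obtain ⟨h1', -⟩ := key w hw
    rw [← hvw] at h1'
    exact mul_right_cancel₀ h2 (h1.symm.trans h1')
  have hnode : ((1 / 3 : F), (1 / 3 : F)) ∉ A.image f := by
    intro h
    obtain ⟨v, hv, hfv⟩ := Finset.mem_image.mp h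
    have h1 := hz v hv
    obtain ⟨a, b, c⟩ := hmem v hv
    rw [hfv] at h1
    apply c
    simp only at h1
    field_simp at h1
    linear_combination h1
  have hsub : insert ((1 / 3 : F), (1 / 3 : F)) (A.image f) ⊆
      Finset.univ.filter (fun p : F × F => 27 * p.1 * p.2 * (1 - p.1 - p.2) = 1) := by
    intro p hp
    rw [Finset.mem_filter]
    refine ⟨Finset.mem_univ _, ?_⟩
    rcases Finset.mem_insert.mp hp with rfl | hp
    · simp only
      field_simp
      ring
    · obtain ⟨v, hv, rfl⟩ := Finset.mem_image.mp hp
      rw [hz v hv]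
      obtain ⟨a, b, c⟩ := hmem v hv
      simp only [f]
      field_simp
      ring
  have := Finset.card_le_card hsub
  rw [Finset.card_insert_of_notMem hnode, Finset.card_image_of_injOn hinj] at this
  omega

lemma K_sum (h3 : (3 : F) ≠ 0) {ρ : MulChar F ℂ} (hρ3 : ρ ^ 3 = 1) :
    ∑ χ : MulChar F ℂ, χ 27 * J3 χ (χ * ρ) (χ * ρ ^ 2) = ((Fintype.card F : ℂ) - 1) *
    (Finset.univ.filter (fun p : F × F => 27 * p.1 * p.2 * (1 - p.1 - p.2) = 1)).card := by
  have e : ∀ χ : MulChar F ℂ, χ 27 * J3 χ (χ * ρ) (χ * ρ ^ 2) =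
      ∑ p : F × F, (ρ p.2 * (ρ ^ 2) (1 - p.1 - p.2)) * χ (27 * p.1 * p.2 * (1 - p.1 - p.2)) := by
    intro χ
    rw [Fintype.sum_prod_type, J3, Finset.mul_sum]
    refine Finset.sum_congr rfl fun x _ => ?_
    rw [Finset.mul_sum]
    refine Finset.sum_congr rfl fun y _ => ?_
    simp only [MulChar.mul_apply, map_mul]
    ring
  rw [Finset.sum_congr rfl fun χ _ => e χ, Finset.sum_comm]
  simp only [← Finset.mul_sum, orth]
  rw [Finset.card_eq_sum_ones, Nat.cast_sum, Finset.sum_filter, Finset.mul_sum]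
  refine Finset.sum_congr rfl fun p _ => ?_
  split_ifs with h
  · rw [cube_term h3 hρ3 _ _ h]; simp
  · simp

/-- triplication formula -/
lemma HD3 (h3' : ringChar F ≠ 3) (hψ : ψ.IsPrimitive) {ρ : MulChar F ℂ} (hρ : ρ ≠ 1)
    (hρ3 : ρ ^ 3 = 1) (χ : MulChar F ℂ) :
    χ 27 * gaussSum χ ψ * gaussSum (χ * ρ) ψ * gaussSum (χ * ρ ^ 2) ψ =
      Fintype.card F * gaussSum (χ ^ 3) ψ := by
  have h3 := three_ne h3'
  have q0 : (Fintype.card F : ℂ) ≠ 0 := qne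
  have e27 : (27 : F) = 3 ^ 3 := by norm_num
  have hρ2 : ρ ^ 2 ≠ 1 := by
    intro h
    apply hρ
    calc ρ = ρ ^ 3 * (ρ ^ 2)⁻¹ := by group
      _ = 1 := by rw [h, hρ3]; simp
  have hρ12 : ρ ≠ ρ ^ 2 := by
    intro h
    apply hρ
    calc ρ = ρ ^ 2 * ρ⁻¹ := by group
      _ = 1 := by rw [← h]; simp
  have hprod : ∀ χ : MulChar F ℂ, χ * (χ * ρ) * (χ * ρ ^ 2) = χ ^ 3 := by
    intro χ
    calc χ * (χ * ρ) * (χ * ρ ^ 2) = χ ^ 3 * ρ ^ 3 := by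
          simp only [pow_succ, pow_zero, one_mul]; ac_rfl
      _ = χ ^ 3 := by rw [hρ3, mul_one]
  have hgρ : gaussSum ρ ψ * gaussSum (ρ ^ 2) ψ = Fintype.card F := by
    have h := g_inv hψ hρ
    have e : ρ⁻¹ = ρ ^ 2 := by
      rw [inv_eq_iff_mul_eq_one, ← pow_succ']; exact hρ3
    have e1 : ρ (-1) = 1 := by
      have a : ρ (-1) ^ 3 = 1 := by
        rw [← MulChar.pow_apply' _ three_ne_zero, hρ3, MulChar.one_apply (by simp)]
      have b := neg_one_sq ρ
      calc ρ (-1) = ρ (-1) ^ 3 := by rw [pow_succ, b, one_mul]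
        _ = 1 := a
    rw [e, e1, one_mul] at h
    exact h
  -- the normalized ratio
  set c : MulChar F ℂ → ℂ := fun χ =>
    χ 27 * gaussSum χ ψ * gaussSum (χ * ρ) ψ * gaussSum (χ * ρ ^ 2) ψ /
      (Fintype.card F * gaussSum (χ ^ 3) ψ) with hc
  have cube1 : ∀ χ : MulChar F ℂ, χ ^ 3 = 1 → χ 27 = 1 := by
    intro χ h
    rw [e27, map_pow, ← MulChar.pow_apply' _ three_ne_zero, h, MulChar.one_apply h3.isUnit]
  have prod1 : ∀ χ : MulChar F ℂ, χ ^ 3 = 1 →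
      gaussSum χ ψ * gaussSum (χ * ρ) ψ * gaussSum (χ * ρ ^ 2) ψ = - Fintype.card F := by
    intro χ h
    rcases chars_cube hρ hρ3 h with rfl | rfl | rfl
    · rw [one_mul, one_mul, mul_assoc, hgρ, g_one hψ]; ring
    · rw [← sq, ← pow_succ', hρ3, hgρ, g_one hψ]; ring
    · rw [← pow_succ, hρ3, ← pow_add, show ρ ^ (2 + 2) = ρ by rw [pow_succ, hρ3, one_mul], g_one hψ]
      linear_combination -hgρ
  have c1 : ∀ χ : MulChar F ℂ, χ ^ 3 = 1 → c χ = 1 := by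
    intro χ h
    simp only [hc]
    rw [cube1 χ h, one_mul, prod1 χ h, h, g_one hψ]
    field_simp
  have cK : ∀ χ : MulChar F ℂ, Fintype.card F * c χ = χ 27 * J3 χ (χ * ρ) (χ * ρ ^ 2) +
      if χ ^ 3 = 1 then (Fintype.card F : ℂ) - 1 else 0 := by
    intro χ
    split_ifs with h
    · rw [c1 χ h, cube1 χ h]
      have hJ : J3 χ (χ * ρ) (χ * ρ ^ 2) = 1 := by
        by_cases hn : χ * ρ = 1
        · have hχ : χ ≠ 1 := by rintro rfl; rw [one_mul] at hn; exact hρ hn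
          have sw : J3 χ (χ * ρ) (χ * ρ ^ 2) = J3 (χ * ρ) χ (χ * ρ ^ 2) := by
            rw [J3, J3, Finset.sum_comm]
            refine Finset.sum_congr rfl fun x _ => Finset.sum_congr rfl fun y _ => ?_
            rw [show 1 - y - x = 1 - x - y by ring]; ring
          have := J3_triv hψ (α := χ * ρ) (β := χ) (γ := χ * ρ ^ 2)
            (by rw [mul_comm (χ * ρ), hprod, h]) hχ
          rw [sw]
          have p := prod1 χ h
          apply mul_left_cancel₀ q0
          linear_combination this - p
        · have := J3_triv hψ (α := χ) (β := χ * ρ) (γ := χ * ρ ^ 2) (by rw [hprod, h]) hn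
          rw [prod1 χ h] at this
          apply mul_left_cancel₀ q0
          linear_combination this
      rw [hJ]; ring
    · have := J3_nontriv (ψ := ψ) (α := χ) (β := χ * ρ) (γ := χ * ρ ^ 2) (by rwa [hprod])
      rw [hprod] at this
      simp only [hc]
      rw [add_zero]
      have g0 := g_ne hψ (χ ^ 3)
      field_simp
      linear_combination χ 27 * this
  have cnorm : ∀ χ : MulChar F ℂ, ‖c χ‖ = 1 := by
    intro χ
    by_cases h : χ ^ 3 = 1
    · rw [c1 χ h]; simp
    · have n1 : χ ≠ 1 := by rintro rfl; simp at h
      have n2 : χ * ρ ≠ 1 := by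
        intro h'
        apply h
        have := congrArg (· ^ 3) h'
        simpa [mul_pow, hρ3] using this
      have n3 : χ * ρ ^ 2 ≠ 1 := by
        intro h'
        apply h
        have := congrArg (· ^ 3) h'
        simpa [mul_pow, ← pow_mul, mul_comm 2 3, pow_mul ρ 3 2, hρ3] using this
      have a0 := g_norm hψ h
      have a1 := g_norm hψ n1
      have a2 := g_norm hψ n2
      have a3 := g_norm hψ n3
      have a4 : ‖χ 27‖ = 1 := by
        have hu : (27 : F) ≠ 0 := by rw [e27]; exact pow_ne_zero _ h3
        have := χ.apply_mem_rootsOfUnity hu.isUnit.unit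
        have := Complex.norm_eq_one_of_mem_rootsOfUnity this
        simpa using this
      have qr : (Fintype.card F : ℝ) ≠ 0 := by exact_mod_cast Fintype.card_ne_zero
      have g0 : ‖gaussSum (χ ^ 3) ψ‖ ≠ 0 := norm_ne_zero_iff.2 (g_ne hψ _)
      have : ‖c χ‖ ^ 2 = 1 := by
        simp only [hc, norm_div, norm_mul, a4, Complex.norm_natCast, one_mul]
        rw [div_pow, mul_pow, mul_pow, mul_pow, a0, a1, a2, a3]
        field_simp
      have h0 := norm_nonneg (c χ)
      nlinarith
  have three : ∑ χ : MulChar F ℂ, (if χ ^ 3 = 1 then (Fintype.card F : ℂ) - 1 else 0) =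
      3 * ((Fintype.card F : ℂ) - 1) := by
    rw [← Finset.sum_filter]
    have : Finset.univ.filter (fun χ : MulChar F ℂ => χ ^ 3 = 1) = {1, ρ, ρ ^ 2} := by
      ext χ
      simp only [Finset.mem_filter, Finset.mem_univ, true_and, Finset.mem_insert,
        Finset.mem_singleton]
      refine ⟨chars_cube hρ hρ3, ?_⟩
      rintro (rfl | rfl | rfl)
      · simp
      · exact hρ3
      · rw [← pow_mul, mul_comm, pow_mul, hρ3, one_pow]
    rw [this, Finset.sum_const, Finset.card_insert_of_notMem, Finset.card_pair hρ12]
    · simp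
    · simp [hρ.symm, hρ2.symm]
  have tot : (Fintype.card F : ℂ) * ∑ χ, c χ = ((Fintype.card F : ℂ) - 1) *
      ((Finset.univ.filter (fun p : F × F => 27 * p.1 * p.2 * (1 - p.1 - p.2) = 1)).card + 3) := by
    rw [Finset.mul_sum, Finset.sum_congr rfl fun χ _ => cK χ, Finset.sum_add_distrib, three,
      K_sum h3 hρ3]
    ring
  have totre : (Fintype.card (MulChar F ℂ) : ℝ) ≤ ∑ χ, (c χ).re := by
    have hcp := card_points h3
    set M := (Finset.univ.filter (fun p : F × F => 27 * p.1 * p.2 * (1 - p.1 - p.2) = 1)).card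
    have hr := congrArg Complex.re tot
    have hr' : (Fintype.card F : ℝ) * ∑ χ, (c χ).re = ((Fintype.card F : ℝ) - 1) * (M + 3) := by
      have e1 : ((Fintype.card F : ℂ) * ∑ χ, c χ).re = (Fintype.card F : ℝ) * ∑ χ, (c χ).re := by
        rw [← Complex.re_sum, ← Complex.ofReal_natCast, Complex.re_ofReal_mul]
      have e2 : (((Fintype.card F : ℂ) - 1) * ((M : ℂ) + 3)).re =
          ((Fintype.card F : ℝ) - 1) * (M + 3) := by
        have : (((Fintype.card F : ℂ) - 1) * ((M : ℂ) + 3)) =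
          ((((Fintype.card F : ℝ) - 1) * (M + 3) : ℝ) : ℂ) := by push_cast; ring
        rw [this, Complex.ofReal_re]
      rw [← e1, ← e2]; exact hr
    have cc : (Fintype.card (MulChar F ℂ) : ℝ) = (Fintype.card F : ℝ) - 1 := by
      have := card_chars (F := F)
      have := congrArg Complex.re this
      simpa using this
    have hq1 : (1 : ℝ) ≤ Fintype.card F := by exact_mod_cast Fintype.card_pos
    have hM : (Fintype.card F : ℝ) ≤ M + 3 := by exact_mod_cast hcp
    rw [cc]
    have : (Fintype.card F : ℝ) * ((Fintype.card F : ℝ) - 1) ≤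
        (Fintype.card F : ℝ) * ∑ χ, (c χ).re := by
      rw [hr']; nlinarith
    exact le_of_mul_le_mul_left this (by linarith)
  have cre : ∀ χ : MulChar F ℂ, (c χ).re ≤ 1 := fun χ =>
    (Complex.re_le_norm _).trans (cnorm χ).le
  have call : ∀ χ : MulChar F ℂ, (c χ).re = 1 := by
    have hs : ∑ χ : MulChar F ℂ, (c χ).re = ∑ χ : MulChar F ℂ, (1 : ℝ) := by
      apply le_antisymm
      · exact Finset.sum_le_sum fun χ _ => cre χ
      · simpa using totre
    intro χ
    exact (Finset.sum_eq_sum_iff_of_le fun χ _ => cre χ).mp hs χ (Finset.mem_univ _)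
  have cχ : c χ = 1 := by
    have h1 := call χ
    have h2 := cnorm χ
    have h3 : (c χ).im = 0 := by
      have := Complex.sq_norm (c χ)
      rw [Complex.normSq_apply, h1, h2] at this
      nlinarith
    exact Complex.ext h1 h3
  have g0 := g_ne hψ (χ ^ 3)
  simp only [hc] at cχ
  rw [div_eq_one_iff_eq (mul_ne_zero q0 g0)] at cχ
  exact cχ


/-- the multiplication formula for `d = 6` -/
lemma HD6 (h2 : ringChar F ≠ 2) (h3 : ringChar F ≠ 3) (hψ : ψ.IsPrimitive) {α : MulChar F ℂ}
    (hα2 : α ^ 2 ≠ 1) (hα3 : α ^ 3 ≠ 1) (hα6 : α ^ 6 = 1) (χ : MulChar F ℂ) :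
    (χ ^ 6) 6 * (gaussSum χ ψ * gaussSum (χ * α) ψ * gaussSum (χ * α ^ 2) ψ *
      gaussSum (χ * α ^ 3) ψ * gaussSum (χ * α ^ 4) ψ * gaussSum (χ * α ^ 5) ψ) =
    Fintype.card F * gaussSum (α ^ 3) ψ ^ 3 * gaussSum (χ ^ 6) ψ := by
  have t2 := two_ne h2
  have p6 : (α ^ 3) ^ 2 = 1 := by rw [← pow_mul]; exact hα6
  have p6' : (α ^ 2) ^ 3 = 1 := by rw [← pow_mul]; exact hα6
  have a0 := HD2 h2 hψ hα3 p6 χ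
  have a1 := HD2 h2 hψ hα3 p6 (χ * α)
  have a2 := HD2 h2 hψ hα3 p6 (χ * α ^ 2)
  have b := HD3 h3 hψ hα2 p6' (χ ^ 2)
  rw [mul_assoc χ, ← pow_succ', mul_pow] at a1
  rw [mul_assoc χ, ← pow_add, mul_pow] at a2
  rw [← pow_mul χ 2 3] at b
  have h4 : α 4 ^ 3 = 1 := by
    rw [show (4 : F) = 2 ^ 2 by norm_num, map_pow, ← pow_mul]
    rw [← MulChar.pow_apply' _ (by norm_num), hα6, MulChar.one_apply t2.isUnit]
  have h6 : (χ ^ 6) 6 = χ 4 ^ 3 * χ 27 ^ 2 := by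
    rw [MulChar.pow_apply' _ (by norm_num), ← map_pow, ← map_pow, ← map_pow, ← map_mul]
    norm_num
  rw [MulChar.mul_apply] at a1 a2
  rw [MulChar.pow_apply' _ two_ne_zero] at a2 b
  rw [h6]
  simp only [show 3 + 1 = 4 from rfl, show 2 + 3 = 5 from rfl, show 2 * 3 = 6 from rfl] at a1 a2 b
  calc χ 4 ^ 3 * χ 27 ^ 2 * (gaussSum χ ψ * gaussSum (χ * α) ψ * gaussSum (χ * α ^ 2) ψ *
      gaussSum (χ * α ^ 3) ψ * gaussSum (χ * α ^ 4) ψ * gaussSum (χ * α ^ 5) ψ)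
      = χ 4 ^ 3 * (α 4 ^ 3) * χ 27 ^ 2 *
      (gaussSum χ ψ * gaussSum (χ * α) ψ * gaussSum (χ * α ^ 2) ψ *
      gaussSum (χ * α ^ 3) ψ * gaussSum (χ * α ^ 4) ψ * gaussSum (χ * α ^ 5) ψ) := by
        rw [h4, mul_one]
    _ = χ 27 ^ 2 * (χ 4 * gaussSum χ ψ * gaussSum (χ * α ^ 3) ψ) *
        (χ 4 * α 4 * gaussSum (χ * α) ψ * gaussSum (χ * α ^ 4) ψ) *
        (χ 4 * α 4 ^ 2 * gaussSum (χ * α ^ 2) ψ * gaussSum (χ * α ^ 5) ψ) := by ring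
    _ = gaussSum (α ^ 3) ψ ^ 3 * (χ 27 ^ 2 * gaussSum (χ ^ 2) ψ * gaussSum (χ ^ 2 * α ^ 2) ψ *
        gaussSum (χ ^ 2 * (α ^ 2) ^ 2) ψ) := by rw [a0, a1, a2]; ring
    _ = _ := by rw [b]; ring

/-- the sum over characters giving Greene's function -/
lemma JJ_sum {α : MulChar F ℂ} (hα : (α ^ 2) (-1) = 1) {L : F} (hL : L ≠ 0) :
    ∑ χ : MulChar F ℂ, jacobiSum χ (χ⁻¹ * α ^ 2) * jacobiSum χ (χ⁻¹ * α) * χ L =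
    ((Fintype.card F : ℂ) - 1) *
      ∑ y : F, (α ^ 2) y * ((α ^ 2)⁻¹ * 1) (1 - y) * α⁻¹ (1 - L⁻¹ * y) := by
  have e : ∀ χ : MulChar F ℂ, jacobiSum χ (χ⁻¹ * α ^ 2) * jacobiSum χ (χ⁻¹ * α) * χ L =
      ∑ x : F, ∑ y : F, (α ^ 2) (1 - x) * α (1 - y) *
        χ (x * (1 - x)⁻¹ * (y * (1 - y)⁻¹) * L) := by
    intro χ
    rw [jacobiSum, jacobiSum, Finset.sum_mul_sum, Finset.sum_mul]
    refine Finset.sum_congr rfl fun x _ => ?_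
    rw [Finset.sum_mul]
    refine Finset.sum_congr rfl fun y _ => ?_
    simp only [MulChar.mul_apply, map_mul, MulChar.inv_apply']
    ring
  rw [Finset.sum_congr rfl fun χ _ => e χ, Finset.sum_comm, Finset.mul_sum]
  refine Fintype.sum_equiv ((Equiv.inv F).trans (Equiv.subLeft 1)) _ _ fun x => ?_
  simp only [Equiv.trans_apply, Equiv.inv_apply, Equiv.subLeft_apply, sub_sub_cancel]
  rw [Finset.sum_comm]
  simp only [← Finset.mul_sum, orth, mul_one]
  by_cases hx0 : x = 0
  · subst hx0
    rw [inv_zero, MulChar.map_zero]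
    simp
  by_cases hx1 : x = 1
  · subst hx1
    rw [inv_one, sub_self, MulChar.map_zero]
    simp
  have hx1' : 1 - x ≠ 0 := sub_ne_zero.2 (Ne.symm hx1)
  have r1 : (α ^ 2) (1 - x⁻¹) * (α ^ 2)⁻¹ x⁻¹ = (α ^ 2) (1 - x) := by
    rw [MulChar.inv_apply', inv_inv, ← map_mul, show (1 - x⁻¹) * x = (-1) * (1 - x) by
      field_simp; ring, map_mul, hα, one_mul]
  rw [r1]
  set d : F := 1 - L⁻¹ * (1 - x⁻¹) with hd
  have hdx : L * x * (d - 1) = 1 - x := by rw [hd]; field_simp; ring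
  have hcond : ∀ y : F, 1 - y ≠ 0 → (x * (1 - x)⁻¹ * (y * (1 - y)⁻¹) * L = 1 ↔ d * (1 - y) = 1) := by
    intro y hy
    have h1 : x * (1 - x)⁻¹ * (y * (1 - y)⁻¹) * L = 1 ↔ x * y * L = (1 - x) * (1 - y) := by
      field_simp
    rw [h1]
    constructor
    · intro h
      apply mul_left_cancel₀ (mul_ne_zero hL hx0)
      linear_combination (1 - y) * hdx - h
    · intro h
      linear_combination (1 - y) * hdx - L * x * h
  have hin : ∑ y : F, α (1 - y) * (if x * (1 - x)⁻¹ * (y * (1 - y)⁻¹) * L = 1 then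
      (Fintype.card F : ℂ) - 1 else 0) = ((Fintype.card F : ℂ) - 1) * α⁻¹ d := by
    have : ∀ y : F, α (1 - y) * (if x * (1 - x)⁻¹ * (y * (1 - y)⁻¹) * L = 1 then
      (Fintype.card F : ℂ) - 1 else 0) =
        if 1 - d⁻¹ = y then ((Fintype.card F : ℂ) - 1) * α⁻¹ d else 0 := by
      intro y
      by_cases hy : 1 - y = 0
      · rw [hy, MulChar.map_zero, zero_mul]
        split_ifs with h
        · have hd0 : d = 0 := by
            have : d⁻¹ = 0 := by linear_combination hy - h
            simpa using this
          rw [hd0, MulChar.map_zero, mul_zero]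
        · rfl
      · rw [if_congr (hcond y hy) rfl rfl]
        by_cases h : d * (1 - y) = 1
        · have hd' : d⁻¹ = 1 - y := inv_eq_of_mul_eq_one_right h
          rw [if_pos h, if_pos (by rw [hd']; ring), MulChar.inv_apply', hd']
          ring
        · rw [if_neg h, mul_zero, eq_comm]
          split_ifs with h'
          · have hd' : d⁻¹ = 1 - y := by linear_combination -h'
            have hd0 : d = 0 := by
              by_contra h0
              exact h (by rw [← hd', mul_inv_cancel₀ h0])
            rw [hd0, MulChar.map_zero, mul_zero]
          · rfl
    rw [Finset.sum_congr rfl fun y _ => this y]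
    simp
  simp only [mul_assoc, ← Finset.mul_sum] at hin ⊢
  rw [hin]
  ring

lemma g_recip (hψ : ψ.IsPrimitive) {χ : MulChar F ℂ} (hχ : χ ≠ 1) :
    (gaussSum χ ψ)⁻¹ = χ (-1) * gaussSum χ⁻¹ ψ / Fintype.card F := by
  have h := g_inv hψ hχ
  have h0 := g_ne hψ χ
  have q0 := qne (F := F)
  have := neg_one_sq χ
  field_simp
  linear_combination (-χ (-1)) * h - (Fintype.card F : ℂ) * this

/-- the whole computation, in terms of Gauss sums -/
lemma core (h2 : ringChar F ≠ 2) (h3 : ringChar F ≠ 3) (hψ : ψ.IsPrimitive) {α : MulChar F ℂ}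
    (hα2 : α ^ 2 ≠ 1) (hα3 : α ^ 3 ≠ 1) (hα6 : α ^ 6 = 1) {lam : F} (hlam : lam ≠ 0) :
    1 / (Fintype.card F : ℂ) * (gaussSum α ψ * gaussSum α ψ * gaussSum α ψ *
      gaussSum (α ^ 2) ψ * gaussSum (α ^ 3) ψ * gaussSum (α ^ 4) ψ) +
    1 / (Fintype.card F : ℂ) * (gaussSum (α ^ 2) ψ * gaussSum (α ^ 2) ψ * gaussSum (α ^ 2) ψ *
      gaussSum (α ^ 3) ψ * gaussSum (α ^ 4) ψ * gaussSum (α ^ 5) ψ) +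
    ((Fintype.card F : ℂ) - 1)⁻¹ * ∑ χ : MulChar F ℂ,
      gaussSum χ ψ * gaussSum χ ψ * gaussSum χ ψ * gaussSum (χ * α) ψ *
        gaussSum (χ * α ^ 2) ψ * gaussSum (χ * α ^ 3) ψ / gaussSum (χ ^ 6) ψ *
          (χ ^ 6) (6 * lam) =
    -(Fintype.card F : ℂ) ^ 2 * J3 α (α ^ 2) (α ^ 3) *
      (1 * (1 / (Fintype.card F : ℂ)) *
        ∑ y : F, (α ^ 2) y * ((α ^ 2)⁻¹ * 1) (1 - y) * α⁻¹ (1 - (lam ^ 6)⁻¹ * y)) := by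
  have q0 := qne (F := F)
  have q1 : (Fintype.card F : ℂ) - 1 ≠ 0 := by
    rw [sub_ne_zero]
    exact_mod_cast (Fintype.one_lt_card (α := F)).ne'
  have hL : lam ^ 6 ≠ 0 := pow_ne_zero _ hlam
  have hα1 : α ≠ 1 := by rintro rfl; simp at hα2
  have i1 : α⁻¹ = α ^ 5 := by rw [inv_eq_iff_mul_eq_one, ← pow_succ']; exact hα6
  have i2 : (α ^ 2)⁻¹ = α ^ 4 := by rw [inv_eq_iff_mul_eq_one, ← pow_add]; exact hα6
  have i3 : (α ^ 3)⁻¹ = α ^ 3 := by rw [inv_eq_iff_mul_eq_one, ← pow_add]; exact hα6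
  set s := α (-1) with hs
  have ss : s ^ 2 = 1 := neg_one_sq α
  have s2 : (α ^ 2) (-1) = 1 := by rw [MulChar.pow_apply' _ two_ne_zero, ss]
  have s3 : (α ^ 3) (-1) = s := by
    rw [MulChar.pow_apply' _ three_ne_zero, pow_succ, ← hs, ss, one_mul]
  have g15 : gaussSum α ψ * gaussSum (α ^ 5) ψ = s * Fintype.card F := by
    rw [← i1]; exact g_inv hψ hα1
  have g24 : gaussSum (α ^ 2) ψ * gaussSum (α ^ 4) ψ = Fintype.card F := by
    rw [← i2, g_inv hψ hα2, s2, one_mul]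
  have g33 : gaussSum (α ^ 3) ψ * gaussSum (α ^ 3) ψ = s * Fintype.card F := by
    have := g_inv hψ hα3
    rwa [i3, s3] at this
  have hJ := J3_triv hψ (α := α) (β := α ^ 2) (γ := α ^ 3)
    (by rw [← pow_succ', ← pow_add]; exact hα6) hα2
  have hJJ := JJ_sum s2 hL
  set T := ∑ y : F, (α ^ 2) y * ((α ^ 2)⁻¹ * 1) (1 - y) * α⁻¹ (1 - (lam ^ 6)⁻¹ * y) with hT
  have n1 := g_ne hψ α
  have n5 := g_ne hψ (α ^ 5)
  set Q : ℂ := (Fintype.card F : ℂ) with hQ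
  have αL : α (lam ^ 6) = 1 := by
    rw [map_pow, ← MulChar.pow_apply' _ (by norm_num), hα6, MulChar.one_apply hlam.isUnit]
  have α2L : (α ^ 2) (lam ^ 6) = 1 := by
    rw [MulChar.pow_apply' _ two_ne_zero, αL, one_pow]
  -- termwise
  have term : ∀ χ : MulChar F ℂ,
      gaussSum χ ψ * gaussSum χ ψ * gaussSum χ ψ * gaussSum (χ * α) ψ *
        gaussSum (χ * α ^ 2) ψ * gaussSum (χ * α ^ 3) ψ / gaussSum (χ ^ 6) ψ *
          (χ ^ 6) (6 * lam) =
      Q * gaussSum (α ^ 3) ψ ^ 3 * (s * gaussSum (α ^ 2) ψ * gaussSum α ψ / Q ^ 2 *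
        (jacobiSum χ (χ⁻¹ * α ^ 2) * jacobiSum χ (χ⁻¹ * α) * χ (lam ^ 6)) +
        ((if χ = α ^ 2 then -(1 - 1 / Q) * gaussSum (α ^ 2) ψ ^ 2 * (gaussSum α ψ)⁻¹ else 0) +
        (if χ = α then -(1 - 1 / Q) * gaussSum α ψ ^ 2 * (gaussSum (α ^ 5) ψ)⁻¹ else 0))) := by
    intro χ
    have hd := HD6 h2 h3 hψ hα2 hα3 hα6 χ
    have m4 := g_ne hψ (χ * α ^ 4)
    have m5 := g_ne hψ (χ * α ^ 5)
    have m6 := g_ne hψ (χ ^ 6)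
    have l1 : gaussSum χ ψ * gaussSum χ ψ * gaussSum χ ψ * gaussSum (χ * α) ψ *
        gaussSum (χ * α ^ 2) ψ * gaussSum (χ * α ^ 3) ψ / gaussSum (χ ^ 6) ψ *
          (χ ^ 6) (6 * lam) = Q * gaussSum (α ^ 3) ψ ^ 3 * (gaussSum χ ψ ^ 2 * χ (lam ^ 6) *
          ((gaussSum (χ * α ^ 4) ψ)⁻¹ * (gaussSum (χ * α ^ 5) ψ)⁻¹)) := by
      rw [map_mul, MulChar.pow_apply' χ (n := 6) (by norm_num) lam, ← map_pow]
      field_simp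
      linear_combination gaussSum χ ψ ^ 2 * χ (lam ^ 6) * hd
    rw [l1]
    congr 1
    have j2 := jacobiSum_mul_nontrivial (χ := χ) (φ := χ⁻¹ * α ^ 2)
      (by rwa [mul_inv_cancel_left]) ψ
    have j1 := jacobiSum_mul_nontrivial (χ := χ) (φ := χ⁻¹ * α) (by rwa [mul_inv_cancel_left]) ψ
    rw [mul_inv_cancel_left] at j1 j2
    have jj : s * gaussSum (α ^ 2) ψ * gaussSum α ψ / Q ^ 2 *
        (jacobiSum χ (χ⁻¹ * α ^ 2) * jacobiSum χ (χ⁻¹ * α) * χ (lam ^ 6)) =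
        gaussSum χ ψ ^ 2 * χ (lam ^ 6) * (s / Q ^ 2 * (gaussSum (χ⁻¹ * α ^ 2) ψ *
          gaussSum (χ⁻¹ * α) ψ)) := by
      calc _ = s / Q ^ 2 * χ (lam ^ 6) * (gaussSum (α ^ 2) ψ * jacobiSum χ (χ⁻¹ * α ^ 2)) *
          (gaussSum α ψ * jacobiSum χ (χ⁻¹ * α)) := by ring
        _ = _ := by rw [j1, j2]; ring
    rw [jj]
    have v4 : (χ * α ^ 4)⁻¹ = χ⁻¹ * α ^ 2 := by rw [mul_inv, ← i2, inv_inv]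
    have v5 : (χ * α ^ 5)⁻¹ = χ⁻¹ * α := by rw [mul_inv, ← i1, inv_inv]
    by_cases c2 : χ = α ^ 2
    · have c1 : χ ≠ α := by
        intro h
        apply hα1
        have : α * α = α * 1 := by rw [mul_one, ← sq, ← c2, h]
        exact mul_left_cancel this
      rw [if_pos c2, if_neg c1, c2, α2L, ← pow_add, ← pow_add, inv_mul_cancel,
        show (α ^ 2)⁻¹ * α = α⁻¹ by rw [sq, mul_inv, inv_mul_cancel_right]]
      simp only [show 2 + 4 = 6 from rfl, show 2 + 5 = 6 + 1 from rfl]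
      rw [pow_succ α 6, hα6, one_mul, g_one hψ, g_recip hψ hα1, ← hs]
      field_simp
      ring
    · by_cases c1 : χ = α
      · rw [if_neg c2, if_pos c1, c1, αL, ← pow_succ', ← pow_succ', inv_mul_cancel,
          show α⁻¹ * α ^ 2 = α by rw [sq, inv_mul_cancel_left]]
        simp only [show 5 + 1 = 6 from rfl, show 4 + 1 = 5 from rfl]
        have h5 : α ^ 5 ≠ 1 := by rw [← i1]; simpa using hα1
        rw [hα6, g_one hψ, g_recip hψ h5]
        have : (α ^ 5)⁻¹ = α := by rw [← i1, inv_inv]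
        have hs5 : (α ^ 5) (-1) = s := by
          rw [MulChar.pow_apply' _ (by norm_num), ← hs]
          linear_combination (s ^ 3 + s) * ss
        rw [this, hs5]
        field_simp
        ring
      · rw [if_neg c2, if_neg c1]
        have d4 : χ * α ^ 4 ≠ 1 := by
          intro h
          apply c2
          rw [← i2] at h
          exact mul_inv_eq_one.mp h
        have d5 : χ * α ^ 5 ≠ 1 := by
          intro h
          apply c1
          rw [← i1] at h
          exact mul_inv_eq_one.mp h
        rw [g_recip hψ d4, g_recip hψ d5, v4, v5, MulChar.mul_apply, MulChar.mul_apply,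
          MulChar.pow_apply' _ (by norm_num), MulChar.pow_apply' _ (by norm_num), ← hs]
        have := neg_one_sq χ
        have hs9 : s ^ 4 * s ^ 5 = s := by
          linear_combination (s ^ 7 + s ^ 5 + s ^ 3 + s) * ss
        rw [add_zero, add_zero]
        congr 1
        calc _ = (χ (-1) ^ 2) * (s ^ 4 * s ^ 5) / Q ^ 2 * (gaussSum (χ⁻¹ * α ^ 2) ψ *
          gaussSum (χ⁻¹ * α) ψ) := by rw [← hQ]; field_simp
          _ = _ := by rw [this, hs9, one_mul]
  rw [Finset.sum_congr rfl fun χ _ => term χ, ← Finset.mul_sum, Finset.sum_add_distrib,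
    ← Finset.mul_sum, hJJ, Finset.sum_add_distrib, Finset.sum_ite_eq' , Finset.sum_ite_eq',
    if_pos (Finset.mem_univ _), if_pos (Finset.mem_univ _)]
  have r1 : (gaussSum α ψ)⁻¹ = s * gaussSum (α ^ 5) ψ / Q := by
    rw [g_recip hψ hα1, i1]
  have r5 : (gaussSum (α ^ 5) ψ)⁻¹ = s * gaussSum α ψ / Q := by
    have hsn : s ≠ 0 := by rintro h; rw [h] at ss; simp at ss
    field_simp
    linear_combination (-s) * g15 - Q * ss
  rw [r1, r5]
  generalize gaussSum α ψ = a1 at *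
  generalize gaussSum (α ^ 2) ψ = a2 at *
  generalize gaussSum (α ^ 3) ψ = a3 at *
  generalize gaussSum (α ^ 4) ψ = a4 at *
  generalize gaussSum (α ^ 5) ψ = a5 at *
  have J' : J3 α (α ^ 2) (α ^ 3) = - (a1 * a2 * a3) / Q := by
    field_simp
    linear_combination hJ
  have e3 : a3 ^ 3 * s = Q * a3 := by
    linear_combination a3 * s * g33 + Q * a3 * ss
  rw [J']
  calc _ = 1 / Q * (a1 ^ 3 * a3 * (a2 * a4) + a2 ^ 2 * a3 * a5 * (a2 * a4)) +
      (Q - 1)⁻¹ * (Q * (a3 ^ 3 * s) * (a2 * a1 / Q ^ 2 * ((Q - 1) * T) +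
        (-(1 - 1 / Q) * a2 ^ 2 * (a5 / Q) + -(1 - 1 / Q) * a1 ^ 2 * (a1 / Q)))) := by ring
    _ = _ := by
      rw [g24, e3]
      field_simp
      ring


/-- the standard additive character of `F` -/
noncomputable def psi (p : ℕ) [Fact p.Prime] (F : Type) [Field F] [Fintype F]
    [Algebra (ZMod p) F] : AddChar F ℂ :=
  (ZMod.stdAddChar : AddChar (ZMod p) ℂ).compAddMonoidHom (Algebra.trace (ZMod p) F).toAddMonoidHom

lemma psi_prim (p : ℕ) [Fact p.Prime] [Algebra (ZMod p) F] : (psi p F).IsPrimitive := by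
  apply AddChar.IsPrimitive.of_ne_one
  intro h
  haveI : Module.Finite (ZMod p) F := Module.Finite.of_finite
  obtain ⟨x, hx⟩ := Algebra.trace_surjective (ZMod p) F 1
  have h1 : psi p F x = 1 := by rw [h]; rfl
  have h2 : (ZMod.stdAddChar : AddChar (ZMod p) ℂ) 1 = 1 := by
    rw [← hx]; exact h1
  have h3 := ((ZMod.isPrimitive_stdAddChar p).zmod_char_eq_one_iff p 1).1 h2
  exact one_ne_zero h3

lemma gaussChar_eq (p : ℕ) [Fact p.Prime] [Algebra (ZMod p) F] (χ : MulChar F ℂ) :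
    gaussChar p F χ = gaussSum χ (psi p F) := by
  unfold gaussChar gaussSum
  refine Finset.sum_congr rfl fun x _ => ?_
  congr 1
  have : psi p F x = (ZMod.stdAddChar : AddChar (ZMod p) ℂ) (Algebra.trace (ZMod p) F x) := rfl
  rw [this]
  generalize Algebra.trace (ZMod p) F x = a
  have h := ZMod.stdAddChar_coe (N := p) (a.val : ℤ)
  rw [Int.cast_natCast, ZMod.natCast_zmod_val] at h
  rw [h]
  push_cast
  rfl

lemma jacobiS_eq (α β γ : MulChar F ℂ) : jacobiS F ![α, β, γ] = J3 α β γ := by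
  unfold jacobiS J3
  rw [← Fintype.sum_prod_type' (f := fun x y : F => α x * β y * γ (1 - x - y))]
  refine Finset.sum_nbij' (fun v => (v 0, v 1)) (fun z => ![z.1, z.2, 1 - z.1 - z.2]) ?_ ?_ ?_ ?_ ?_
  · simp
  · intro z _
    rw [Finset.mem_filter]
    refine ⟨Finset.mem_univ _, ?_⟩
    rw [Fin.sum_univ_three]
    simp
  · intro v hv
    rw [Finset.mem_filter, Fin.sum_univ_three] at hv
    funext i
    fin_cases i
    · rfl
    · rfl
    · simp
      linear_combination -hv.2
  · intro z _
    rfl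
  · intro v hv
    rw [Finset.mem_filter, Fin.sum_univ_three] at hv
    rw [Fin.prod_univ_three]
    have : 1 - v 0 - v 1 = v 2 := by linear_combination -hv.2
    simp [this]

lemma NqW_zero (p : ℕ) [Algebra (ZMod p) F] (ω : MulChar F ℂ) (w : Fin 6 → ZMod 6)
    (h0 : ¬ ∀ i, w i = 0) (h1 : ¬ ∀ i, w i ≠ 0) : NqW p F ω 6 w = 0 := by
  unfold NqW
  rw [if_neg h0, if_neg h1]

lemma NqW_ne (p : ℕ) [Algebra (ZMod p) F] (ω : MulChar F ℂ) (w : Fin 6 → ZMod 6)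
    (h1 : ∀ i, w i ≠ 0) : NqW p F ω 6 w = (1 / (Fintype.card F : ℂ)) *
      ∏ i, gaussChar p F (ω ^ ((w i).val * ((Fintype.card F - 1) / 6))) := by
  unfold NqW
  rw [if_neg (fun h => h1 0 (h 0)), if_pos h1]

lemma NqW_sum (p : ℕ) [Fact p.Prime] [Algebra (ZMod p) F] (ω α : MulChar F ℂ)
    (hα : α = ω ^ ((Fintype.card F - 1) / 6)) :
    (∑ k ∈ Finset.range 6,
      NqW p F ω 6 (fun i => (![0,0,0,1,2,3] : Fin 6 → ZMod 6) i + (k : ZMod 6))) =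
    1 / (Fintype.card F : ℂ) * (gaussSum α (psi p F) * gaussSum α (psi p F) *
      gaussSum α (psi p F) *
      gaussSum (α ^ 2) (psi p F) * gaussSum (α ^ 3) (psi p F) * gaussSum (α ^ 4) (psi p F)) +
    1 / (Fintype.card F : ℂ) * (gaussSum (α ^ 2) (psi p F) * gaussSum (α ^ 2) (psi p F) *
      gaussSum (α ^ 2) (psi p F) *
      gaussSum (α ^ 3) (psi p F) * gaussSum (α ^ 4) (psi p F) * gaussSum (α ^ 5) (psi p F)) := by
  have hp : ∀ m : ℕ, ω ^ (m * ((Fintype.card F - 1) / 6)) = α ^ m := by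
    intro m; rw [hα, ← pow_mul, mul_comm]
  have f1 : (fun i => (![0,0,0,1,2,3] : Fin 6 → ZMod 6) i + ((1 : ℕ) : ZMod 6)) =
      ![1,1,1,2,3,4] := by decide
  have f2 : (fun i => (![0,0,0,1,2,3] : Fin 6 → ZMod 6) i + ((2 : ℕ) : ZMod 6)) =
      ![2,2,2,3,4,5] := by decide
  have v1 : (1 : ZMod 6).val = 1 := rfl
  have v2 : (2 : ZMod 6).val = 2 := rfl
  have v3 : (3 : ZMod 6).val = 3 := rfl
  have v4 : (4 : ZMod 6).val = 4 := rfl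
  have v5 : (5 : ZMod 6).val = 5 := rfl
  simp only [Finset.sum_range_succ, Finset.sum_range_zero]
  rw [NqW_zero p ω _ (by decide) (by decide), f1, f2, NqW_ne p ω ![1,1,1,2,3,4] (by decide),
    NqW_ne p ω ![2,2,2,3,4,5] (by decide),
    NqW_zero p ω _ (by decide) (by decide), NqW_zero p ω _ (by decide) (by decide), NqW_zero p ω _ (by decide) (by decide),
    Fin.prod_univ_six, Fin.prod_univ_six]
  simp only [hp, gaussChar_eq]
  rw [zero_add, zero_add, add_zero, add_zero, add_zero]
  change 1 / (Fintype.card F : ℂ) * (gaussSum (α ^ 1) (psi p F) * gaussSum (α ^ 1) (psi p F) *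
      gaussSum (α ^ 1) (psi p F) *
      gaussSum (α ^ 2) (psi p F) * gaussSum (α ^ 3) (psi p F) * gaussSum (α ^ 4) (psi p F)) +
    1 / (Fintype.card F : ℂ) * (gaussSum (α ^ 2) (psi p F) * gaussSum (α ^ 2) (psi p F) *
      gaussSum (α ^ 2) (psi p F) *
      gaussSum (α ^ 3) (psi p F) * gaussSum (α ^ 4) (psi p F) * gaussSum (α ^ 5) (psi p F)) = _
  rw [pow_one]

lemma SW_eq (p : ℕ) [Fact p.Prime] [Algebra (ZMod p) F] (ω α : MulChar F ℂ)
    (hω : ∀ χ : MulChar F ℂ, ∃ j : ℕ, χ = ω ^ j)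
    (hα : α = ω ^ ((Fintype.card F - 1) / 6)) (lam : F) :
    SW p F ω 6 (fun _ => 1) (![0,0,0,1,2,3] : Fin 6 → ZMod 6) lam =
    ((Fintype.card F : ℂ) - 1)⁻¹ * ∑ χ : MulChar F ℂ,
      gaussSum χ (psi p F) * gaussSum χ (psi p F) * gaussSum χ (psi p F) *
        gaussSum (χ * α) (psi p F) *
        gaussSum (χ * α ^ 2) (psi p F) * gaussSum (χ * α ^ 3) (psi p F) /
          gaussSum (χ ^ 6) (psi p F) * (χ ^ 6) (6 * lam) := by
  have hp : ∀ m j : ℕ, ω ^ (m * ((Fintype.card F - 1) / 6) + 1 * j) = ω ^ j * α ^ m := by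
    intro m j; rw [hα, ← pow_mul, ← pow_add]; congr 1; ring
  have hj : ∀ j : ℕ, ω ^ (6 * j) = (ω ^ j) ^ 6 := by
    intro j; rw [← pow_mul, mul_comm]
  unfold SW
  simp only [gaussChar_eq, hp, hj]
  rw [sum_range_eq ω hω (fun χ => (∏ i, gaussSum (χ * α ^ ((![0,0,0,1,2,3] : Fin 6 → ZMod 6) i).val)
    (psi p F)) / gaussSum (χ ^ 6) (psi p F) * (χ ^ 6) (((6 : ℕ) : F) * lam))]
  congr 1
  refine Finset.sum_congr rfl fun χ _ => ?_
  rw [Fin.prod_univ_six]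
  change gaussSum (χ * α ^ 0) (psi p F) * gaussSum (χ * α ^ 0) (psi p F) *
    gaussSum (χ * α ^ 0) (psi p F) * gaussSum (χ * α ^ 1) (psi p F) *
        gaussSum (χ * α ^ 2) (psi p F) * gaussSum (χ * α ^ 3) (psi p F) /
          gaussSum (χ ^ 6) (psi p F) * (χ ^ 6) (((6 : ℕ) : F) * lam) = _
  rw [pow_zero, pow_one, mul_one, Nat.cast_ofNat]

lemma greene_eq {α : MulChar F ℂ} {x : F} (hx : x ≠ 0) :
    greene2F1 F α (α ^ 2) 1 x = 1 * (1 / (Fintype.card F : ℂ)) *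
        ∑ y : F, (α ^ 2) y * ((α ^ 2)⁻¹ * 1) (1 - y) * α⁻¹ (1 - x * y) := by
  unfold greene2F1
  rw [MulChar.one_apply hx.isUnit, mul_one (α ^ 2), MulChar.pow_apply' _ two_ne_zero, neg_one_sq]

lemma ringChar_ne (hmod : Fintype.card F % 6 = 1) : ringChar F ≠ 2 ∧ ringChar F ≠ 3 := by
  have h : ringChar F ∣ Fintype.card F := by
    obtain ⟨n, hp, hn⟩ := FiniteField.card F (ringChar F)
    rw [hn]
    exact dvd_pow_self _ n.pos.ne'
  constructor <;> intro h' <;> rw [h'] at h <;> omega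

end HDProof

/-- The contribution of the class of `w = (0,0,0,1,2,3)` in Koblitz's formula. -/
theorem class_000123 (p e q t : ℕ) [Fact p.Prime] (F : Type) [Field F] [Fintype F]
    [Algebra (ZMod p) F]
    (he : 0 < e) (hq : q = Fintype.card F) (hqe : q = p ^ e) (hmod : q % 6 = 1)
    (ht : t = (q - 1) / 6)
    (ω : MulChar F ℂ) (hω : ∀ χ : MulChar F ℂ, ∃ j : ℕ, χ = ω ^ j)
    (ω₆ ω₃ ω₂ : MulChar F ℂ)
    (hω₆ : ω₆ = ω ^ t) (hω₃ : ω₃ = ω ^ (2 * t)) (hω₂ : ω₂ = ω ^ (3 * t))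
    (lam : F) (hlam : lam ≠ 0) (hlam6 : lam ^ 6 ≠ 1) :
    (∑ k ∈ Finset.range 6, NqW p F ω 6 (fun i => (![0,0,0,1,2,3] : Fin 6 → ZMod 6) i + (k : ZMod 6))) +
      SW p F ω 6 (fun _ => 1) (![0,0,0,1,2,3] : Fin 6 → ZMod 6) lam =
      -((q : ℂ) ^ 2) * jacobiS F ![ω₆, ω₃, ω₂] * greene2F1 F ω₆ ω₃ 1 (lam ^ 6)⁻¹ := by
  subst hq hω₆ hω₃ hω₂
  obtain ⟨h2, h3⟩ := HDProof.ringChar_ne (F := F) hmod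
  have hord := HDProof.gen_order ω hω
  have h1 : 1 < Fintype.card F := Fintype.one_lt_card
  have h6t : Fintype.card F - 1 = 6 * t := by omega
  have hne : ∀ m : ℕ, 0 < m → m < 6 → (ω ^ t) ^ m ≠ 1 := by
    intro m hm0 hm h
    rw [← pow_mul] at h
    have hd := orderOf_dvd_of_pow_eq_one h
    rw [hord, h6t] at hd
    have ht0 : 0 < t := by omega
    have hle := Nat.le_of_dvd (Nat.mul_pos ht0 hm0) hd
    nlinarith
  have hα6 : (ω ^ t) ^ 6 = 1 := by
    rw [← pow_mul, mul_comm, ← h6t, ← hord, pow_orderOf_eq_one]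
  have e2 : ω ^ (2 * t) = (ω ^ t) ^ 2 := by rw [← pow_mul, mul_comm]
  have e3 : ω ^ (3 * t) = (ω ^ t) ^ 3 := by rw [← pow_mul, mul_comm]
  have hα : ω ^ t = ω ^ ((Fintype.card F - 1) / 6) := by rw [ht]
  rw [HDProof.NqW_sum p ω (ω ^ t) hα, HDProof.SW_eq p ω (ω ^ t) hω hα, e2, e3,
    HDProof.jacobiS_eq, HDProof.greene_eq (inv_ne_zero (pow_ne_zero 6 hlam))]
  exact HDProof.core h2 h3 (HDProof.psi_prim p) (hne 2 (by norm_num) (by norm_num))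
    (hne 3 (by norm_num) (by norm_num)) hα6 hlam
end
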